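/- arXiv:2002.01748 — 2 statements merged into one kernel-verified Lean document; each statement's English description precedes it below -/
import Mathlib

section
/- For integers n, k, r with n ≥ rk and r ≥ 2, and a partition P = {P_1, ..., P_l} of [n] with |P_i| ≤ r for all i, the chromatic number of the r-uniform hypergraph KG^r(n,k,P) equals ⌈(n - r(k-1))/(r-1)⌉. -/
open Finset

/-- A coloring of the vertices is proper if no edge is monochromatic. -/
def IsProperColoring {V : Type*} (E : Set (Multiset V)) {t : ℕ} (c : V → Fin t) : Prop :=
  ∀ e ∈ E, ∃ a ∈ e, ∃ b ∈ e, c a ≠ c b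

/-- The chromatic number of a hypergraph with edge set `E`, as an extended natural number
(infinity if no proper coloring exists). -/
noncomputable def hypChromatic {V : Type*} (E : Set (Multiset V)) : ℕ∞ :=
  sInf {N : ℕ∞ | ∃ t : ℕ, N = (t : ℕ∞) ∧ ∃ c : V → Fin t, IsProperColoring E c}

/-- `P : Fin l → Finset (Fin n)` is a partition of `[n]` into nonempty blocks. -/
def IsPartition (n l : ℕ) (P : Fin l → Finset (Fin n)) : Prop :=
  (∀ j, (P j).Nonempty) ∧ ∀ x : Fin n, ∃! j, x ∈ P j

/-- Vertices of `KG^r(n,k,P)`: `k`-subsets of `[n]` meeting each block of `P`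
in at most one element. -/
def KGPVertex (n k l : ℕ) (P : Fin l → Finset (Fin n)) : Type :=
  {A : Finset (Fin n) // A.card = k ∧ ∀ j, (A ∩ P j).card ≤ 1}

/-- Edges of `KG^r(n,k,P)`: `r`-subsets of vertices that are pairwise disjoint. -/
def KGPEdges (n k l r : ℕ) (P : Fin l → Finset (Fin n)) :
    Set (Multiset (KGPVertex n k l P)) :=
  {e | Multiset.card e = r ∧ e.Nodup ∧
    ∀ a ∈ e, ∀ b ∈ e, a ≠ b → Disjoint a.1 b.1}

section Cochains

variable {V W R : Type*} [CommRing R]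

/-- The simplicial coboundary of a function on ordered simplices: the value on a list is the
alternating sum of the values on the lists with one entry removed. -/
def cobd : (List V → R) → List V → R
  | _, [] => 0
  | φ, v :: L => φ L - cobd (fun M => φ (v :: M)) L

lemma cobd_zero (L : List V) : cobd (fun _ => (0 : R)) L = 0 := by
  induction L with
  | nil => rfl
  | cons v L ih => simp [cobd, ih]

lemma cobd_sub (φ ψ : List V → R) (L : List V) :
    cobd (fun M => φ M - ψ M) L = cobd φ L - cobd ψ L := by
  induction L generalizing φ ψ with
  | nil => simp [cobd]
  | cons v L ih => simp only [cobd, ih]; ring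

lemma cobd_const_mul (r : R) (φ : List V → R) (L : List V) :
    cobd (fun M => r * φ M) L = r * cobd φ L := by
  induction L generalizing φ with
  | nil => simp [cobd]
  | cons v L ih => simp only [cobd, ih]; ring

lemma cobd_sum {ι : Type*} (s : Finset ι) (φ : ι → List V → R) (L : List V) :
    cobd (fun M => ∑ i ∈ s, φ i M) L = ∑ i ∈ s, cobd (φ i) L := by
  induction L generalizing φ with
  | nil => simp [cobd]
  | cons v L ih => simp only [cobd, ih, Finset.sum_sub_distrib]

lemma cobd_map (g : V → W) (φ : List W → R) (L : List V) :
    cobd φ (L.map g) = cobd (fun M => φ (M.map g)) L := by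
  induction L generalizing φ with
  | nil => rfl
  | cons v L ih => simp only [cobd, ih, List.map_cons]

lemma cobd_congr {φ ψ : List V → R} {L : List V}
    (h : ∀ M, M.Sublist L → M.length + 1 = L.length → φ M = ψ M) : cobd φ L = cobd ψ L := by
  induction L generalizing φ ψ with
  | nil => rfl
  | cons v L ih =>
    simp only [cobd]
    rw [h L (List.sublist_cons_self v L) rfl,
      ih fun M hM hl => h (v :: M) (hM.cons_cons v) (by simp [hl])]

lemma cobd_cobd (φ : List V → R) (L : List V) : cobd (cobd φ) L = 0 := by
  induction L generalizing φ with
  | nil => rfl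
  | cons v L ih => simp only [cobd, cobd_sub, ih]; ring

/-- The pullback of a cochain along barycentric subdivision followed by a vertex labelling `lab` of
the subdivision: on a simplex with `n` vertices this is the signed sum of the values of `φ` on the
label sequences of all its full flags. -/
def flagSum (lab : List V → W) : ℕ → (List W → R) → List V → R
  | 0, φ, _ => φ []
  | n + 1, φ, L => cobd (flagSum lab n fun N => φ (lab L :: N)) L

variable (lab : List V → W)

lemma flagSum_sub (n : ℕ) (φ ψ : List W → R) (L : List V) :
    flagSum lab n (fun N => φ N - ψ N) L = flagSum lab n φ L - flagSum lab n ψ L := by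
  induction n generalizing φ ψ L with
  | zero => rfl
  | succ n ih =>
    simp only [flagSum]
    rw [← cobd_sub]
    exact congrArg (cobd · L) (funext fun M => ih _ _ M)

lemma flagSum_sum {ι : Type*} (s : Finset ι) (n : ℕ) (φ : ι → List W → R) (L : List V) :
    flagSum lab n (fun N => ∑ i ∈ s, φ i N) L = ∑ i ∈ s, flagSum lab n (φ i) L := by
  induction n generalizing φ L with
  | zero => rfl
  | succ n ih =>
    simp only [flagSum]
    rw [← cobd_sum]
    exact congrArg (cobd · L) (funext fun M => ih _ M)

lemma flagSum_congr {n : ℕ} {φ ψ : List W → R} (L : List V)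
    (h : ∀ N, N.length = n → φ N = ψ N) : flagSum lab n φ L = flagSum lab n ψ L := by
  induction n generalizing φ ψ L with
  | zero => exact h [] rfl
  | succ n ih =>
    simp only [flagSum]
    exact congrArg (cobd · L) (funext fun M => ih M fun N hN => h _ (by simp [hN]))

lemma flagSum_cobd (n : ℕ) (φ : List W → R) (L : List V) (hL : L.length = n + 1) :
    flagSum lab (n + 1) (cobd φ) L = cobd (flagSum lab n φ) L := by
  induction n generalizing φ L with
  | zero =>
    obtain ⟨v, rfl⟩ := List.length_eq_one_iff.1 hL
    simp [flagSum, cobd]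
  | succ n ih =>
    rw [flagSum]
    simp only [cobd]
    rw [show (flagSum lab (n + 1) fun N => φ N - cobd (fun M => φ (lab L :: M)) N) =
      fun M => flagSum lab (n + 1) φ M - flagSum lab (n + 1) (cobd fun M => φ (lab L :: M)) M from
      funext fun M => flagSum_sub _ _ _ _ _, cobd_sub,
      cobd_congr (φ := flagSum lab (n + 1) (cobd fun M => φ (lab L :: M)))
        (ψ := cobd (flagSum lab n fun M => φ (lab L :: M)))
        (fun M _ hM => ih _ M (by omega)), cobd_cobd, sub_zero]

lemma flagSum_map {g : V → V} {g' : W → W} (h : ∀ L, L ≠ [] → lab (L.map g) = g' (lab L))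
    (n : ℕ) (φ : List W → R) (L : List V) (hL : L.length = n) :
    flagSum lab n φ (L.map g) = flagSum lab n (fun N => φ (N.map g')) L := by
  induction n generalizing φ L with
  | zero => rfl
  | succ n ih =>
    simp only [flagSum, cobd_map]
    refine cobd_congr fun M _ hM => ?_
    rw [ih _ M (by omega), h L (by rintro rfl; simp at hL)]
    rfl

/-- A flag sum vanishes if `φ` vanishes on the labels of each full flag. -/
lemma flagSum_eq_zero (n : ℕ) (φ : List W → R) (L : List V) (hL : L.length = n)
    (h : ∀ F : List (List V), F.length = n →
      F.Pairwise (fun A B => B.Sublist A ∧ B.length < A.length) →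
      (∀ M ∈ F, M.Sublist L ∧ M ≠ []) → φ (F.map lab) = 0) :
    flagSum lab n φ L = 0 := by
  induction n generalizing φ L with
  | zero => exact h [] rfl List.Pairwise.nil (by simp)
  | succ n ih =>
    have hne : L ≠ [] := by rintro rfl; simp at hL
    rw [flagSum, ← cobd_zero (R := R) L]
    refine cobd_congr fun M hM hl => ih _ M (by omega) fun F hF hp hs => ?_
    refine h (L :: F) (by simp [hF]) ?_ ?_
    · refine List.pairwise_cons.2 ⟨fun A hA => ⟨(hs A hA).1.trans hM, ?_⟩, hp⟩
      have := (hs A hA).1.length_le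
      omega
    · intro A hA
      rcases List.mem_cons.1 hA with rfl | hA
      · exact ⟨List.Sublist.refl _, hne⟩
      · exact ⟨(hs A hA).1.trans hM, (hs A hA).2⟩

end Cochains

section CyclicCochains

variable {p : ℕ}

/-- Extension of a cochain by one factor given by a two-dimensional cochain. -/
def cupTwo {G R : Type*} [CommRing R] (β : G → G → G → R) (χ : List G → R) : List G → R
  | a :: b :: c :: L => β a b c * χ (c :: L)
  | _ => 0

/-- The indicator of a wrap-around between two residues. -/
def wrap (x y : ZMod p) : ZMod p := if y.val < x.val then 1 else 0

/-- The coboundary of `wrap`, which is invariant under translations. -/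
def carry (x y z : ZMod p) : ZMod p := wrap y z - wrap x z + wrap x y

lemma wrap_self (x : ZMod p) : wrap x x = 0 := by simp [wrap]

/-- The wrap-around indicator measures the failure of `ZMod.val` to respect subtraction. -/
lemma val_sub_eq [NeZero p] (x y : ZMod p) :
    ((y - x).val : ℤ) = y.val - x.val + p * (if y.val < x.val then 1 else 0) := by
  have hx := ZMod.val_lt x
  have hy := ZMod.val_lt y
  have hp : 0 < p := NeZero.pos p
  split_ifs with h
  · have e : y - x = ((y.val + p - x.val : ℕ) : ZMod p) := by
      rw [Nat.cast_sub (by omega)]; simp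
    rw [e, ZMod.val_natCast, Nat.mod_eq_of_lt (by omega)]; omega
  · rw [ZMod.val_sub (by omega)]; omega

lemma carry_add [NeZero p] (x y z h : ZMod p) : carry (x + h) (y + h) (z + h) = carry x y z := by
  have key : ∀ a b c : ZMod p, carry a b c =
      (((if c.val < b.val then 1 else 0) - (if c.val < a.val then 1 else 0) +
        (if b.val < a.val then 1 else 0) : ℤ) : ZMod p) := by
    intro a b c; simp [carry, wrap]
  rw [key, key]
  congr 1
  have hp : (p : ℤ) ≠ 0 := by exact_mod_cast NeZero.ne p
  apply mul_left_cancel₀ hp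
  have h1 := val_sub_eq (x + h) (y + h)
  have h2 := val_sub_eq (y + h) (z + h)
  have h3 := val_sub_eq (x + h) (z + h)
  have h4 := val_sub_eq x y
  have h5 := val_sub_eq y z
  have h6 := val_sub_eq x z
  rw [add_sub_add_right_eq_sub] at h1 h2 h3
  linear_combination h4 + h5 - h6 - h1 - h2 + h3

lemma sum_wrap_add [NeZero p] (x y : ZMod p) : ∑ h, wrap (x + h) (y + h) = y - x := by
  have key : ∑ h : ZMod p, (if (y + h).val < (x + h).val then 1 else 0 : ℤ) = (y - x).val := by
    have hp : (p : ℤ) ≠ 0 := by exact_mod_cast NeZero.ne p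
    apply mul_left_cancel₀ hp
    have e : ∀ h : ZMod p, (p : ℤ) * (if (y + h).val < (x + h).val then 1 else 0 : ℤ) =
        (y - x).val - ((y + h).val - (x + h).val) := by
      intro h
      have := val_sub_eq (x + h) (y + h)
      rw [add_sub_add_right_eq_sub] at this
      linear_combination -this
    have t (c : ZMod p) : ∑ h, ((c + h).val : ℤ) = ∑ h : ZMod p, (h.val : ℤ) :=
      Equiv.sum_comp (Equiv.addLeft c) fun h : ZMod p => (h.val : ℤ)
    rw [Finset.mul_sum, Finset.sum_congr rfl fun h _ => e h, Finset.sum_sub_distrib,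
      Finset.sum_sub_distrib, t y, t x]
    simp [ZMod.card]
  have := congrArg (Int.cast : ℤ → ZMod p) key
  push_cast at this
  simpa [wrap] using this

lemma cupTwo_cobd (χ : List (ZMod p) → ZMod p) (L : List (ZMod p)) (hL : 4 ≤ L.length) :
    cobd (cupTwo carry χ) L = cupTwo carry (cobd χ) L := by
  match L, hL with
  | a :: b :: c :: e :: L, _ =>
    have h := cobd_const_mul (carry a b c) (fun M => χ (c :: M)) (e :: L)
    simp only [cobd, cupTwo] at h ⊢
    rw [h]
    simp only [carry]
    ring

/-- The generating cocycle on simplices with `n` vertices. -/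
def genCocycle : ℕ → List (ZMod p) → ZMod p
  | 0 => fun _ => 0
  | 1 => fun _ => 1
  | 2 => fun L => match L with
    | [a, b] => b - a
    | _ => 0
  | n + 3 => cupTwo carry (genCocycle (n + 1))

/-- A primitive of `genCocycle (n + 1)`. -/
def genPrimitive : ℕ → List (ZMod p) → ZMod p
  | 0 => fun _ => 0
  | 1 => fun L => match L with
    | [a] => a
    | _ => 0
  | 2 => fun L => match L with
    | [a, b] => wrap a b
    | _ => 0
  | n + 3 => cupTwo carry (genPrimitive (n + 1))

lemma cobd_genPrimitive (n : ℕ) (L : List (ZMod p)) (hL : L.length = n + 2) :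
    cobd (genPrimitive (n + 1)) L = genCocycle (n + 2) L := by
  induction n using Nat.twoStepInduction generalizing L with
  | zero =>
    obtain ⟨a, b, rfl⟩ := List.length_eq_two.1 hL
    simp [cobd, genPrimitive, genCocycle]
  | one =>
    obtain ⟨a, b, c, rfl⟩ := List.length_eq_three.1 hL
    simp [cobd, genPrimitive, genCocycle, carry, cupTwo]
    ring
  | more n ih _ =>
    rw [genPrimitive, genCocycle, cupTwo_cobd _ _ (by omega)]
    match L, hL with
    | a :: b :: c :: L, hL =>
      simp only [cupTwo]
      rw [ih _ (by simpa using hL)]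

lemma genCocycle_eq_zero (n : ℕ) (L : List (ZMod p)) (hL : L.length = n + 1)
    (h : ¬ L.IsChain (· ≠ ·)) : genCocycle (n + 1) L = 0 := by
  induction n using Nat.twoStepInduction generalizing L with
  | zero =>
    obtain ⟨a, rfl⟩ := List.length_eq_one_iff.1 hL
    simp at h
  | one =>
    obtain ⟨a, b, rfl⟩ := List.length_eq_two.1 hL
    simp at h
    simp [genCocycle, h]
  | more n ih _ =>
    match L, hL with
    | a :: b :: c :: L, hL =>
      simp only [genCocycle, cupTwo]
      by_cases hab : a = b
      · simp [hab, carry, wrap_self]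
      by_cases hbc : b = c
      · simp [hbc, carry, wrap_self]
      rw [ih (c :: L) (by simpa using hL), mul_zero]
      simpa [hab, hbc] using h

/-- The norm element and the difference element of the group ring of `ZMod p`, in alternation,
acting on functions; in degree zero the identity. -/
def alternator [NeZero p] {V : Type*} (sh : ZMod p → V → V) (n : ℕ) (φ : List V → ZMod p)
    (L : List V) : ZMod p :=
  if n = 0 then φ L else if Even n then ∑ h, φ (L.map (sh h)) else φ (L.map (sh 1)) - φ L

lemma alternator_sub [NeZero p] {V : Type*} (sh : ZMod p → V → V) (n : ℕ)
    (φ ψ : List V → ZMod p) (L : List V) :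
    alternator sh n (fun M => φ M - ψ M) L = alternator sh n φ L - alternator sh n ψ L := by
  unfold alternator
  split_ifs
  · rfl
  · rw [Finset.sum_sub_distrib]
  · ring

lemma cupTwo_carry_map_add [NeZero p] (χ : List (ZMod p) → ZMod p) (L : List (ZMod p))
    (h : ZMod p) : cupTwo carry χ (L.map (· + h)) = cupTwo carry (fun M => χ (M.map (· + h))) L := by
  match L with
  | [] => rfl
  | [a] => rfl
  | [a, b] => rfl
  | a :: b :: c :: L => simp [cupTwo, carry_add]

lemma alternator_genPrimitive [NeZero p] (n : ℕ) (L : List (ZMod p)) (hL : L.length = n + 1) :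
    alternator (fun h x => x + h) (n + 1) (genPrimitive (n + 1)) L = genCocycle (n + 1) L := by
  induction n using Nat.twoStepInduction generalizing L with
  | zero =>
    obtain ⟨a, rfl⟩ := List.length_eq_one_iff.1 hL
    simp [alternator, genPrimitive, genCocycle]
  | one =>
    obtain ⟨a, b, rfl⟩ := List.length_eq_two.1 hL
    simp [alternator, genPrimitive, genCocycle, sum_wrap_add]
  | more n ih _ =>
    match L, hL with
    | a :: b :: c :: L, hL =>
      have := ih (c :: L) (by simpa using hL)
      have e : Even (n + 2 + 1) ↔ Even (n + 1) := by
        simp [Nat.even_add_one]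
      simp only [alternator, genPrimitive, genCocycle, e, cupTwo_carry_map_add] at this ⊢
      simp only [cupTwo]
      rw [← this]
      simp only [Nat.add_eq_zero_iff, one_ne_zero, and_false, if_false]
      split_ifs
      · rw [Finset.mul_sum]
      · ring

end CyclicCochains

section Tucker

variable {p : ℕ} {α : Type*}

/-- Translation of the sign of a signed element. -/
def shiftSign (h : ZMod p) (x : α × ZMod p) : α × ZMod p := (x.1, x.2 + h)

lemma shiftSign_shiftSign (h h' : ZMod p) (L : List (α × ZMod p)) :
    (L.map (shiftSign h)).map (shiftSign h') = L.map (shiftSign (h + h')) := by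
  simp [shiftSign, Function.comp_def, add_assoc]

lemma map_fst_shiftSign (h : ZMod p) (L : List (α × ZMod p)) :
    (L.map (shiftSign h)).map Prod.fst = L.map Prod.fst := by
  simp [shiftSign, Function.comp_def]

variable [NeZero p]

lemma alternator_cobd {V : Type*} (sh : ZMod p → V → V) (n : ℕ) (φ : List V → ZMod p)
    (L : List V) : alternator sh n (cobd φ) L = cobd (alternator sh n φ) L := by
  unfold alternator
  split_ifs
  · rfl
  · simp only [cobd_map, cobd_sum]
  · simp only [cobd_map, cobd_sub]

lemma alternator_alternator (n : ℕ) (φ : List (α × ZMod p) → ZMod p) (L : List (α × ZMod p)) :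
    alternator shiftSign (n + 1) (alternator shiftSign (n + 2) φ) L = 0 := by
  have key (c : ZMod p) : ∑ h, φ (L.map (shiftSign (c + h))) = ∑ h, φ (L.map (shiftSign h)) :=
    Equiv.sum_comp (Equiv.addLeft c) fun h => φ (L.map (shiftSign h))
  have key' (c : ZMod p) : ∑ h, φ (L.map (shiftSign (h + c))) = ∑ h, φ (L.map (shiftSign h)) :=
    Equiv.sum_comp (Equiv.addRight c) fun h => φ (L.map (shiftSign h))
  by_cases hn : Even n
  · simp [alternator, Nat.even_add_one, hn, shiftSign_shiftSign, -List.map_map, key]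
  · simp [alternator, Nat.even_add_one, hn, shiftSign_shiftSign, -List.map_map, key']

lemma alternator_flagSum {lab : List (α × ZMod p) → ZMod p}
    (hlab : ∀ h, ∀ L, L ≠ [] → lab (L.map (shiftSign h)) = lab L + h) (n m : ℕ)
    (φ : List (ZMod p) → ZMod p) (L : List (α × ZMod p)) (hL : L.length = m) :
    alternator shiftSign n (flagSum lab m φ) L =
      flagSum lab m (alternator (fun h x => x + h) n φ) L := by
  have key (h : ZMod p) := flagSum_map lab (g := shiftSign h) (g' := (· + h)) (hlab h) m φ L hL
  unfold alternator
  split_ifs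
  · rfl
  · rw [flagSum_sum]
    exact Finset.sum_congr rfl fun h _ => key h
  · rw [flagSum_sub, key]

/-- Evaluation of a cochain on a chain representing the generator of the top homology of the
quotient of the iterated join of copies of `ZMod p` by translations. -/
def evalJoin : List α → (List (α × ZMod p) → ZMod p) → ZMod p
  | [], φ => φ []
  | a :: l, φ => evalJoin l (alternator shiftSign l.length fun M => φ ((a, 0) :: M))

lemma evalJoin_congr {l : List α} {φ ψ : List (α × ZMod p) → ZMod p}
    (h : ∀ L, L.map Prod.fst = l → φ L = ψ L) : evalJoin l φ = evalJoin l ψ := by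
  induction l generalizing φ ψ with
  | nil => exact h [] rfl
  | cons a l ih =>
    refine ih fun L hL => ?_
    have key (M : List (α × ZMod p)) (hM : M.map Prod.fst = l) :
        φ ((a, 0) :: M) = ψ ((a, 0) :: M) := h _ (by simp [hM])
    unfold alternator
    split_ifs
    · exact key L hL
    · exact Finset.sum_congr rfl fun h _ => key _ (by rw [map_fst_shiftSign, hL])
    · exact congrArg₂ (· - ·) (key _ (by rw [map_fst_shiftSign, hL])) (key L hL)

lemma evalJoin_zero (l : List α) : evalJoin l (fun _ : List (α × ZMod p) => 0) = 0 := by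
  induction l with
  | nil => rfl
  | cons a l ih =>
    have e : alternator shiftSign l.length (fun _ : List (α × ZMod p) => (0 : ZMod p)) =
        fun _ => 0 := by
      funext L
      simp [alternator]
    rw [evalJoin, e, ih]

lemma evalJoin_sub (l : List α) (φ ψ : List (α × ZMod p) → ZMod p) :
    evalJoin l (fun L => φ L - ψ L) = evalJoin l φ - evalJoin l ψ := by
  induction l generalizing φ ψ with
  | nil => rfl
  | cons a l ih =>
    simp only [evalJoin]
    rw [← ih]
    exact congrArg (evalJoin l) (funext fun L => alternator_sub _ _ _ _ L)

lemma evalJoin_cobd (a : α) (l : List α) (φ : List (α × ZMod p) → ZMod p) :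
    evalJoin (a :: l) (cobd φ) = evalJoin l (alternator shiftSign l.length φ) := by
  induction l generalizing a φ with
  | nil => simp [evalJoin, alternator, cobd]
  | cons b l ih =>
    have e : alternator shiftSign (b :: l).length (fun M => cobd φ ((a, (0 : ZMod p)) :: M)) =
        fun L => alternator shiftSign (b :: l).length φ L -
          cobd (alternator shiftSign (b :: l).length fun M => φ ((a, 0) :: M)) L := by
      funext L
      rw [← alternator_cobd]
      exact alternator_sub _ _ _ _ L
    rw [evalJoin, e, evalJoin_sub, ih, sub_eq_self]
    rcases l with _ | ⟨c, l⟩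
    · simp [evalJoin, alternator]
    · rw [← evalJoin_zero (p := p) (c :: l)]
      congr 1
      funext L
      exact alternator_alternator l.length _ L

lemma evalJoin_flagSum_genCocycle {lab : List (α × ZMod p) → ZMod p}
    (hlab : ∀ h, ∀ L, L ≠ [] → lab (L.map (shiftSign h)) = lab L + h) (l : List α) (n : ℕ)
    (hl : l.length = n + 1) :
    evalJoin l (flagSum lab (n + 1) (genCocycle (n + 1))) = 1 := by
  induction n generalizing l with
  | zero =>
    obtain ⟨a, rfl⟩ := List.length_eq_one_iff.1 hl
    simp [evalJoin, alternator, flagSum, genCocycle, cobd]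
  | succ n ih =>
    obtain ⟨a, l, rfl⟩ := List.exists_cons_of_length_eq_add_one hl
    have hl' : l.length = n + 1 := by simpa using hl
    rw [← ih l hl', evalJoin_congr (ψ := cobd (flagSum lab (n + 1) (genPrimitive (n + 1)))),
      evalJoin_cobd]
    · refine evalJoin_congr fun L hL => ?_
      have hL' : L.length = n + 1 := by rw [← hl', ← hL, List.length_map]
      rw [alternator_flagSum hlab _ _ _ _ hL', hl']
      exact flagSum_congr lab L fun N hN => alternator_genPrimitive n N hN
    · intro L hL
      have hL' : L.length = n + 2 := by rw [← List.length_map Prod.fst, hL, hl]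
      rw [← flagSum_cobd lab _ _ _ hL']
      exact flagSum_congr lab L fun N hN => (cobd_genPrimitive n N hN).symm

/-- A Tucker lemma for `ZMod p`: signed lists over `l` are given a rank that is monotone and a sign
that is equivariant and, along proper inclusions, only changes when the rank does. Then the number
of ranks is at least the length of `l`. -/
theorem length_le_of_equivariant_labelling [Fact (1 < p)] (l : List α) (d : ℕ)
    (lab : List (α × ZMod p) → ZMod p) (rk : List (α × ZMod p) → ℕ)
    (hlab : ∀ h, ∀ L, L ≠ [] → lab (L.map (shiftSign h)) = lab L + h)
    (hpos : ∀ L, L ≠ [] → (L.map Prod.fst).Sublist l → 1 ≤ rk L)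
    (hle : ∀ L, (L.map Prod.fst).Sublist l → rk L ≤ d)
    (hmono : ∀ L M, (L.map Prod.fst).Sublist l → M.Sublist L → M.length < L.length → M ≠ [] →
      rk M < rk L ∨ rk M = rk L ∧ lab M = lab L) : l.length ≤ d := by
  by_contra! hd
  obtain ⟨n, hn⟩ : ∃ n, l.length = n + 1 := ⟨l.length - 1, by omega⟩
  have key := evalJoin_flagSum_genCocycle hlab l n hn
  rw [evalJoin_congr (ψ := fun _ => 0), evalJoin_zero] at key
  · exact zero_ne_one key
  · intro L hL
    refine flagSum_eq_zero lab _ _ _ (by rw [← List.length_map Prod.fst, hL, hn]) ?_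
    intro F hF hp hs
    refine genCocycle_eq_zero n _ (by simpa using hF) fun hc => ?_
    have hsub (M) (hM : M ∈ F) : (M.map Prod.fst).Sublist l := hL ▸ (hs M hM).1.map Prod.fst
    have h1 : F.IsChain fun A B => rk B < rk A := by
      rw [List.isChain_map] at hc
      rw [List.isChain_iff_getElem] at hc ⊢
      intro i hi
      have hAB := List.pairwise_iff_getElem.1 hp i (i + 1) (by omega) hi (by omega)
      rcases hmono _ _ (hsub _ (List.getElem_mem _)) hAB.1 hAB.2 (hs _ (List.getElem_mem _)).2
        with h | h
      · exact h
      · exact absurd h.2.symm (hc i hi)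
    have h2 : (F.map rk).Pairwise (· > ·) := by
      rw [List.pairwise_map]
      have : IsTrans (List (α × ZMod p)) fun A B => rk B < rk A :=
        ⟨fun _ _ _ hab hbc => hbc.trans hab⟩
      exact List.isChain_iff_pairwise.1 h1
    have h3 : (F.map rk).toFinset ⊆ Finset.Icc 1 d := by
      intro x hx
      simp only [List.mem_toFinset, List.mem_map] at hx
      obtain ⟨M, hM, rfl⟩ := hx
      exact Finset.mem_Icc.2 ⟨hpos M (hs M hM).2 (hsub M hM), hle M (hsub M hM)⟩
    have h4 := Finset.card_le_card h3
    rw [List.toFinset_card_of_nodup h2.nodup] at h4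
    simp at h4
    omega

end Tucker

section PrimeCase

variable {p : ℕ} [Fact p.Prime] {α β : Type*}

/-- The mean of a set of residues, an equivariant choice of a residue for each nonempty proper
subset of `ZMod p`. -/
def meanSign (T : Finset (ZMod p)) : ZMod p := (∑ x ∈ T, x) / (T.card : ZMod p)

lemma meanSign_map (T : Finset (ZMod p)) (hT : (T.card : ZMod p) ≠ 0) (h : ZMod p) :
    meanSign (T.map (Equiv.addRight h).toEmbedding) = meanSign T + h := by
  simp only [meanSign, Finset.sum_map, Finset.card_map, Equiv.coe_toEmbedding,
    Equiv.coe_addRight, Finset.sum_add_distrib, Finset.sum_const, nsmul_eq_mul]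
  field_simp

lemma cast_card_ne_zero {T : Finset (ZMod p)} (h : T.Nonempty) (h' : T ≠ Finset.univ) :
    (T.card : ZMod p) ≠ 0 := by
  rw [Ne, ZMod.natCast_eq_zero_iff]
  refine Nat.not_dvd_of_pos_of_lt h.card_pos ?_
  simpa [ZMod.card] using (Finset.card_lt_iff_ne_univ T).2 h'

open Classical in
/-- An equivariant choice of a residue for a family of sets of residues, with a default value for
families in which the set sizes are multiples of `p`. -/
noncomputable def pickSign {ι : Type*} (F : ι → Finset (ZMod p)) (d : ZMod p) : ZMod p :=
  if h : {i | ((F i).card : ZMod p) ≠ 0}.Nonempty then meanSign (F h.some) else d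

open Classical in
lemma pickSign_map {ι : Type*} (F : ι → Finset (ZMod p)) (d h : ZMod p) :
    pickSign (fun i => (F i).map (Equiv.addRight h).toEmbedding) (d + h) = pickSign F d + h := by
  have e : {i | (((F i).map (Equiv.addRight h).toEmbedding).card : ZMod p) ≠ 0} =
      {i | ((F i).card : ZMod p) ≠ 0} := by simp only [Finset.card_map]
  have cast (I J : Set ι) (hIJ : I = J) (G : ι → Finset (ZMod p)) (x : ZMod p) :
      (if h : I.Nonempty then meanSign (G h.some) else x) =
        if h : J.Nonempty then meanSign (G h.some) else x := by subst hIJ; rfl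
  refine Eq.trans (b := if h' : {i | ((F i).card : ZMod p) ≠ 0}.Nonempty then
    meanSign ((F h'.some).map (Equiv.addRight h).toEmbedding) else d + h)
    (cast _ _ e (fun i => (F i).map (Equiv.addRight h).toEmbedding) _) ?_
  unfold pickSign
  split_ifs with hF
  · exact meanSign_map _ hF.some_mem h
  · rfl

lemma pickSign_eq_of_card_ne_zero {ι : Type*} (F : ι → Finset (ZMod p)) {i : ι}
    (hi : ((F i).card : ZMod p) ≠ 0) (d d' : ZMod p) : pickSign F d = pickSign F d' := by
  have : {i | ((F i).card : ZMod p) ≠ 0}.Nonempty := ⟨i, hi⟩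
  simp only [pickSign, dif_pos this]

open Classical in
/-- The signs for which the elements of that sign form a set with property `Q`. -/
noncomputable def signsOf (Q : Set α → Prop) (L : List (α × ZMod p)) : Finset (ZMod p) :=
  {ε | Q {a | (a, ε) ∈ L}}

lemma mem_signsOf {Q : Set α → Prop} {L : List (α × ZMod p)} {ε : ZMod p} :
    ε ∈ signsOf Q L ↔ Q {a | (a, ε) ∈ L} := by
  simp [signsOf]

lemma signsOf_shiftSign (Q : Set α → Prop) (L : List (α × ZMod p)) (h : ZMod p) :
    signsOf Q (L.map (shiftSign h)) = (signsOf Q L).map (Equiv.addRight h).toEmbedding := by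
  ext ε
  have e : {a | (a, ε) ∈ L.map (shiftSign h)} = {a | (a, ε - h) ∈ L} := by
    ext a
    simp only [shiftSign, List.mem_map, Set.mem_ofPred_eq, Prod.mk.injEq, Prod.exists]
    constructor
    · rintro ⟨a, x, hx, rfl, rfl⟩
      simpa using hx
    · exact fun hx => ⟨a, ε - h, hx, rfl, by simp⟩
  rw [Finset.mem_map_equiv, mem_signsOf, mem_signsOf, e]
  simp [sub_eq_add_neg]

lemma signsOf_mono {Q : Set α → Prop} (hQ : ∀ X Y, X ⊆ Y → Q X → Q Y)
    {L M : List (α × ZMod p)} (h : M ⊆ L) : signsOf Q M ⊆ signsOf Q L := by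
  intro ε hε
  rw [mem_signsOf] at hε ⊢
  exact hQ _ _ (fun a ha => h ha) hε

/-- A set meets the block `b`. -/
def MeetsBlock (f : α → β) (b : β) (X : Set α) : Prop := ∃ a ∈ X, f a = b

/-- A set contains a partial transversal of size `k` and color `j`. -/
def HasTransversal (f : α → β) (k : ℕ) (c : Finset α → ℕ) (j : ℕ) (X : Set α) : Prop :=
  ∃ A : Finset α, ↑A ⊆ X ∧ A.card = k ∧ Set.InjOn f A ∧ c A = j

lemma MeetsBlock.mono (f : α → β) (b : β) (X Y : Set α) (h : X ⊆ Y) :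
    MeetsBlock f b X → MeetsBlock f b Y := fun ⟨a, ha, hb⟩ => ⟨a, h ha, hb⟩

lemma HasTransversal.mono (f : α → β) (k : ℕ) (c : Finset α → ℕ) (j : ℕ) (X Y : Set α)
    (h : X ⊆ Y) : HasTransversal f k c j X → HasTransversal f k c j Y :=
  fun ⟨A, hA, hb⟩ => ⟨A, hA.trans h, hb⟩

/-- A signed list meeting many pairs of a block and a sign contains a transversal of one sign. -/
lemma exists_hasTransversal (f : α → β) (k : ℕ) (B : Finset β)
    (L : List (α × ZMod p))
    (h : p * (k - 1) < ∑ b ∈ B, (signsOf (MeetsBlock f b) L).card) :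
    ∃ A : Finset α, ∃ ε, (∀ a ∈ A, (a, ε) ∈ L) ∧ A.card = k ∧ Set.InjOn f A := by
  classical
  have hsum : ∑ b ∈ B, (signsOf (MeetsBlock f b) L).card =
      ∑ ε : ZMod p, (B.filter fun b => MeetsBlock f b {a | (a, ε) ∈ L}).card := by
    simp only [signsOf, Finset.card_filter]
    exact Finset.sum_comm
  have hlt : ∑ _ε : ZMod p, (k - 1) < ∑ b ∈ B, (signsOf (MeetsBlock f b) L).card := by
    simpa [ZMod.card] using h
  rw [hsum] at hlt
  obtain ⟨ε, -, hε⟩ := Finset.exists_lt_of_sum_lt hlt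
  obtain ⟨B', hB', hk⟩ := Finset.exists_subset_card_eq
    (show k ≤ (B.filter fun b => MeetsBlock f b {a | (a, ε) ∈ L}).card by omega)
  have hch : ∀ b : B', ∃ a, (a, ε) ∈ L ∧ f a = b := fun b =>
    (Finset.mem_filter.1 (hB' b.2)).2
  choose g hg hfg using hch
  refine ⟨Finset.univ.image g, ε, ?_, ?_, ?_⟩
  · simp only [Finset.mem_image, Finset.mem_univ, true_and]
    rintro _ ⟨b, rfl⟩
    exact hg b
  · rw [Finset.card_image_of_injective, Finset.card_univ, Fintype.card_coe, hk]
    intro b b' hb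
    exact Subtype.ext (by rw [← hfg b, ← hfg b', hb])
  · intro x hx y hy hxy
    simp only [Finset.coe_image, Finset.coe_univ, Set.image_univ, Set.mem_range] at hx hy
    obtain ⟨b, rfl⟩ := hx
    obtain ⟨b', rfl⟩ := hy
    rw [hfg, hfg] at hxy
    rw [Subtype.ext hxy]

/-- If a signed list is properly contained in another one that uses each element once, and the
blocks have at most `p` elements, then some set of signs in a block grows or is nonempty and
proper. -/
lemma exists_block_of_length_lt (f : α → β) (S : Finset α)
    (hf : ∀ b, {a | a ∈ S ∧ f a = b}.ncard ≤ p)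
    {L M : List (α × ZMod p)} (hL : (L.map Prod.fst).Nodup) (hLS : ∀ x ∈ L, x.1 ∈ S)
    (hM : M.Sublist L) (hlt : M.length < L.length)
    (heq : ∀ b, signsOf (MeetsBlock f b) M = signsOf (MeetsBlock f b) L) :
    ∃ b, ((signsOf (MeetsBlock f b) L).card : ZMod p) ≠ 0 := by
  classical
  obtain ⟨⟨a, ε⟩, hxL, hxM⟩ : ∃ x ∈ L, x ∉ M := by
    by_contra! h
    exact absurd ((hL.of_map _).subperm h).length_le (by omega)
  have hne : (signsOf (MeetsBlock f (f a)) L).Nonempty := ⟨ε, mem_signsOf.2 ⟨a, hxL, rfl⟩⟩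
  refine ⟨f a, cast_card_ne_zero hne fun huniv => ?_⟩
  rw [← heq] at huniv
  have hch : ∀ e : ZMod p, ∃ x, (x, e) ∈ M ∧ f x = f a := fun e =>
    mem_signsOf.1 (huniv ▸ Finset.mem_univ e)
  choose g hg hfg using hch
  have hinj : Function.Injective g := by
    intro e e' he
    have := List.inj_on_of_nodup_map hL (hM.subset (hg e)) (hM.subset (hg e')) he
    exact (Prod.ext_iff.1 this).2
  have hsub : insert a (Finset.univ.image g) ⊆ S.filter fun x => f x = f a := by
    intro x hx
    rw [Finset.mem_insert, Finset.mem_image] at hx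
    rw [Finset.mem_filter]
    rcases hx with rfl | ⟨e, -, rfl⟩
    · exact ⟨hLS _ hxL, rfl⟩
    · exact ⟨hLS _ (hM.subset (hg e)), hfg e⟩
  have hna : a ∉ Finset.univ.image g := by
    rw [Finset.mem_image]
    rintro ⟨e, -, he⟩
    have := List.inj_on_of_nodup_map hL (hM.subset (hg e)) hxL he
    exact hxM (this ▸ hg e)
  have hcard := Finset.card_le_card hsub
  rw [Finset.card_insert_of_notMem hna, Finset.card_image_of_injective _ hinj, Finset.card_univ,
    ZMod.card] at hcard
  have h3 := hf (f a)
  rw [← Finset.coe_filter, Set.ncard_coe_finset] at h3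
  omega

/-- The lower bound for a prime number of sets: a coloring with few colors of the partial
transversals of size `k` has `p` disjoint ones of the same color. -/
theorem exists_monochromatic_of_prime (f : α → β) (S : Finset α)
    (hf : ∀ b, {a | a ∈ S ∧ f a = b}.ncard ≤ p) (c : Finset α → ℕ) (k t : ℕ)
    (hc : ∀ A ⊆ S, A.card = k → Set.InjOn f A → c A < t)
    (hS : p * (k - 1) + t * (p - 1) + 1 ≤ S.card) :
    ∃ F : Fin p → Finset α, (∀ i, F i ⊆ S ∧ (F i).card = k ∧ Set.InjOn f (F i)) ∧
      (∀ i j, i ≠ j → Disjoint (F i) (F j)) ∧ ∀ i j, c (F i) = c (F j) := by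
  classical
  by_contra hno
  have hmem {L : List (α × ZMod p)} (hL : (L.map Prod.fst).Sublist S.toList) :
      ∀ x ∈ L, x.1 ∈ S := fun x hx =>
    Finset.mem_toList.1 (hL.subset (List.mem_map_of_mem hx))
  have hnodup {L : List (α × ZMod p)} (hL : (L.map Prod.fst).Sublist S.toList) :
      (L.map Prod.fst).Nodup := S.nodup_toList.sublist hL
  have hproper (L : List (α × ZMod p)) (hL : (L.map Prod.fst).Sublist S.toList) (j : ℕ) :
      signsOf (HasTransversal f k c j) L ≠ Finset.univ := by
    intro huniv
    have hch : ∀ ε : ZMod p, HasTransversal f k c j {a | (a, ε) ∈ L} := fun ε =>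
      mem_signsOf.1 (huniv ▸ Finset.mem_univ ε)
    choose A hA hAk hAf hAc using hch
    let e : Fin p ≃ ZMod p := Fintype.equivOfCardEq (by simp [ZMod.card])
    refine hno ⟨fun i => A (e i), fun i => ⟨fun a ha => hmem hL _ (hA _ ha), hAk _, hAf _⟩,
      fun i i' hi => ?_, fun i i' => by rw [hAc, hAc]⟩
    rw [Finset.disjoint_left]
    intro a ha ha'
    have := List.inj_on_of_nodup_map (hnodup hL) (hA _ ha) (hA _ ha') rfl
    exact hi (e.injective (Prod.ext_iff.1 this).2)
  let N (L : List (α × ZMod p)) : ℕ := ∑ b ∈ S.image f, (signsOf (MeetsBlock f b) L).card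
  let C (L : List (α × ZMod p)) : ℕ :=
    ∑ j ∈ Finset.range t, (signsOf (HasTransversal f k c j) L).card
  let d (L : List (α × ZMod p)) : ZMod p := (L.head?.map Prod.snd).getD 0
  let rk (L : List (α × ZMod p)) : ℕ := if N L ≤ p * (k - 1) then N L else p * (k - 1) + C L
  let lab (L : List (α × ZMod p)) : ZMod p :=
    if N L ≤ p * (k - 1) then pickSign (fun b => signsOf (MeetsBlock f b) L) (d L)
    else pickSign (fun j => signsOf (HasTransversal f k c j) L) (d L)
  have hbig (L : List (α × ZMod p)) (hL : (L.map Prod.fst).Sublist S.toList)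
      (hN : ¬ N L ≤ p * (k - 1)) :
      ∃ j < t, (signsOf (HasTransversal f k c j) L).Nonempty := by
    obtain ⟨A, ε, hA, hAk, hAf⟩ := exists_hasTransversal f k (S.image f) L (not_le.1 hN)
    exact ⟨c A, hc A (fun a ha => hmem hL _ (hA a ha)) hAk hAf, ε, mem_signsOf.2
      ⟨A, hA, hAk, hAf, rfl⟩⟩
  have hCpos (L : List (α × ZMod p)) (hL : (L.map Prod.fst).Sublist S.toList)
      (hN : ¬ N L ≤ p * (k - 1)) : 1 ≤ C L := by
    obtain ⟨j, hj, hne⟩ := hbig L hL hN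
    exact hne.card_pos.trans_le
      (Finset.single_le_sum (f := fun j => (signsOf (HasTransversal f k c j) L).card)
        (fun _ _ => Nat.zero_le _) (Finset.mem_range.2 hj))
  have key := length_le_of_equivariant_labelling S.toList (p * (k - 1) + t * (p - 1)) lab rk
    ?_ ?_ ?_ ?_
  · rw [Finset.length_toList] at key
    omega
  · intro h L hL
    have hd : d (L.map (shiftSign h)) = d L + h := by
      obtain ⟨x, L, rfl⟩ := List.exists_cons_of_ne_nil hL
      simp [d, shiftSign]
    have hN : N (L.map (shiftSign h)) = N L := by
      simp only [N, signsOf_shiftSign, Finset.card_map]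
    simp only [lab, hN, hd, signsOf_shiftSign, pickSign_map]
    split_ifs <;> rfl
  · intro L hL hLS
    simp only [rk]
    split_ifs with hN
    · obtain ⟨⟨a, ε⟩, L, rfl⟩ := List.exists_cons_of_ne_nil hL
      refine le_trans ?_ (Finset.single_le_sum
        (f := fun b => (signsOf (MeetsBlock f b) ((a, ε) :: L)).card)
        (fun _ _ => Nat.zero_le _) (Finset.mem_image_of_mem f (hmem hLS (a, ε) (by simp))))
      exact Finset.card_pos.2 ⟨ε, mem_signsOf.2 ⟨a, by simp, rfl⟩⟩
    · have := hCpos L hLS hN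
      omega
  · intro L hLS
    simp only [rk]
    split_ifs with hN
    · omega
    · have : C L ≤ t * (p - 1) := by
        refine (Finset.sum_le_card_nsmul _ _ (p - 1) fun j _ => ?_).trans (by simp)
        have := (Finset.card_lt_iff_ne_univ _).2 (hproper L hLS j)
        rw [ZMod.card] at this
        omega
      omega
  · intro L M hLS hML hlt hM
    have hMS : (M.map Prod.fst).Sublist S.toList := (hML.map _).trans hLS
    have hmN (b : β) := signsOf_mono (MeetsBlock.mono f b) hML.subset
    have hmC (j : ℕ) := signsOf_mono (HasTransversal.mono f k c j) hML.subset
    have hN : N M ≤ N L := Finset.sum_le_sum fun b _ => Finset.card_le_card (hmN b)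
    have hC : C M ≤ C L := Finset.sum_le_sum fun j _ => Finset.card_le_card (hmC j)
    by_cases hNL : N L ≤ p * (k - 1)
    · have hNM : N M ≤ p * (k - 1) := hN.trans hNL
      simp only [rk, lab, if_pos hNL, if_pos hNM]
      rcases hN.lt_or_eq with h | h
      · exact .inl h
      refine .inr ⟨h, ?_⟩
      have heq (b : β) : signsOf (MeetsBlock f b) M = signsOf (MeetsBlock f b) L := by
        by_cases hb : b ∈ S.image f
        · exact Finset.eq_of_subset_of_card_le (hmN b)
            ((Finset.sum_eq_sum_iff_of_le fun b _ => Finset.card_le_card (hmN b)).1 h b hb).ge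
        · refine (hmN b).antisymm fun ε hε => ?_
          obtain ⟨a, ha, rfl⟩ := mem_signsOf.1 hε
          exact absurd (Finset.mem_image_of_mem f (hmem hLS _ ha)) hb
      obtain ⟨b, hb⟩ := exists_block_of_length_lt f S hf (hnodup hLS) (hmem hLS) hML hlt heq
      simp only [heq]
      exact pickSign_eq_of_card_ne_zero (fun b => signsOf (MeetsBlock f b) L) hb _ _
    · by_cases hNM : N M ≤ p * (k - 1)
      · left
        simp only [rk, if_neg hNL, if_pos hNM]
        have := hCpos L hLS hNL
        omega
      simp only [rk, lab, if_neg hNL, if_neg hNM]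
      rcases hC.lt_or_eq with h | h
      · exact .inl (by omega)
      refine .inr ⟨by omega, ?_⟩
      have heq (j : ℕ) : signsOf (HasTransversal f k c j) M =
          signsOf (HasTransversal f k c j) L := by
        by_cases hj : j < t
        · exact Finset.eq_of_subset_of_card_le (hmC j)
            ((Finset.sum_eq_sum_iff_of_le fun j _ => Finset.card_le_card (hmC j)).1 h j
              (Finset.mem_range.2 hj)).ge
        · refine (hmC j).antisymm fun ε hε => ?_
          obtain ⟨A, hA, hAk, hAf, rfl⟩ := mem_signsOf.1 hε
          exact absurd (hc A (fun a ha => hmem hLS _ (hA ha)) hAk hAf) hj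
      obtain ⟨j, -, hne⟩ := hbig L hLS hNL
      simp only [heq]
      exact pickSign_eq_of_card_ne_zero (fun j => signsOf (HasTransversal f k c j) L)
        (cast_card_ne_zero hne (hproper L hLS j)) _ _

end PrimeCase

section GeneralCase

lemma exists_injOn_fin_prod {α : Type*} {T : Set α} (hT : T.Finite) {m n : ℕ} (hm : 0 < m)
    (hn : 0 < n) (h : T.ncard ≤ m * n) : ∃ g : α → Fin m × Fin n, Set.InjOn g T := by
  classical
  have : Fintype T := hT.fintype
  obtain ⟨g⟩ : Nonempty (T ↪ Fin m × Fin n) :=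
    Function.Embedding.nonempty_of_card_le (by
      rw [← Nat.card_eq_fintype_card, Nat.card_coe_set_eq]
      simpa using h)
  refine ⟨fun x => if hx : x ∈ T then g ⟨x, hx⟩ else (⟨0, hm⟩, ⟨0, hn⟩), fun x hx y hy hxy => ?_⟩
  simp only [dif_pos hx, dif_pos hy] at hxy
  exact congrArg Subtype.val (g.injective hxy)

/-- A coloring with few colors of the partial transversals of size `k` has `r` disjoint ones of the
same color. -/
theorem exists_monochromatic {α : Type*} {β : Type*} (r : ℕ) (f : α → β) (S : Finset α)
    (hf : ∀ b, {a | a ∈ S ∧ f a = b}.ncard ≤ r) (c : Finset α → ℕ) (k t : ℕ)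
    (hc : ∀ A ⊆ S, A.card = k → Set.InjOn f A → c A < t)
    (hS : r * (k - 1) + t * (r - 1) + 1 ≤ S.card) :
    ∃ F : Fin r → Finset α, (∀ i, F i ⊆ S ∧ (F i).card = k ∧ Set.InjOn f (F i)) ∧
      (∀ i j, i ≠ j → Disjoint (F i) (F j)) ∧ ∀ i j, c (F i) = c (F j) := by
  classical
  induction r using induction_on_primes generalizing β S c k t with
  | zero => exact ⟨fun _ => ∅, fun i => i.elim0, fun i => i.elim0, fun i => i.elim0⟩
  | one =>
    obtain ⟨A, hA, hk⟩ := Finset.exists_subset_card_eq (show k ≤ S.card by omega)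
    refine ⟨fun _ => A, fun _ => ⟨hA, hk, fun x hx y hy hxy => ?_⟩,
      fun i j h => absurd (Subsingleton.elim i j) h, fun _ _ => rfl⟩
    exact (Set.ncard_le_one (S.finite_toSet.subset fun a ha => ha.1)).1 (hf (f y)) x
      ⟨hA hx, hxy⟩ y ⟨hA hy, rfl⟩
  | prime_mul p a hp ih =>
    rcases Nat.eq_zero_or_pos a with rfl | ha
    · have he (i : Fin (p * 0)) : False := i.elim0
      exact ⟨fun _ => ∅, fun i => (he i).elim, fun i => (he i).elim, fun i => (he i).elim⟩
    have : Fact p.Prime := ⟨hp⟩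
    have hfin (b : β) : {x | x ∈ S ∧ f x = b}.Finite := S.finite_toSet.subset fun x hx => hx.1
    choose g hg using fun b => exists_injOn_fin_prod (hfin b) hp.pos ha (hf b)
    let f' (x : α) : β × Fin a := (f x, (g (f x) x).2)
    let Good (A : Finset α) (F : Fin a → Finset α) : Prop :=
      (∀ i, F i ⊆ A ∧ (F i).card = k ∧ Set.InjOn f (F i)) ∧
        (∀ i j, i ≠ j → Disjoint (F i) (F j)) ∧ ∀ i j, c (F i) = c (F j)
    let c' (A : Finset α) : ℕ := if h : ∃ F, Good A F then c (h.choose ⟨0, ha⟩) else 0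
    have hGood (A : Finset α) (hA : A ⊆ S) (hcard : A.card = a * (k - 1) + t * (a - 1) + 1)
        (hinj : Set.InjOn f' A) : ∃ F, Good A F := by
      refine ih f A (fun b => ?_) c k t (fun B hB => hc B (hB.trans hA)) hcard.ge
      have := Set.ncard_le_ncard_of_injOn (s := {x | x ∈ A ∧ f x = b}) (t := Set.univ)
        (fun x => (g b x).2) (fun _ _ => Set.mem_univ _) (by
          rintro x ⟨hx, rfl⟩ y ⟨hy, hxy⟩ h
          exact hinj hx hy (Prod.ext hxy.symm (by simpa [f', hxy] using h)))
      simpa using this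
    have main := exists_monochromatic_of_prime (p := p) f' S (fun b => ?_) c'
      (a * (k - 1) + t * (a - 1) + 1) t (fun A hA hcard hinj => ?_) ?_
    · obtain ⟨A, hA, hdisj, hcol⟩ := main
      have hex (i : Fin p) : ∃ F, Good (A i) F :=
        hGood (A i) (hA i).1 (hA i).2.1 (hA i).2.2
      obtain ⟨G, hF, hc'⟩ : ∃ G : Fin p → Fin a → Finset α, (∀ i, Good (A i) (G i)) ∧
          ∀ i, c' (A i) = c (G i ⟨0, ha⟩) :=
        ⟨fun i => (hex i).choose, fun i => (hex i).choose_spec, fun i => dif_pos (hex i)⟩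
      refine ⟨fun x => G (finProdFinEquiv.symm x).1 (finProdFinEquiv.symm x).2,
        fun x => ⟨((hF _).1 _).1.trans (hA _).1, ((hF _).1 _).2⟩, fun x y hxy => ?_,
        fun x y => ?_⟩
      · obtain ⟨⟨i, j⟩, rfl⟩ := finProdFinEquiv.surjective x
        obtain ⟨⟨i', j'⟩, rfl⟩ := finProdFinEquiv.surjective y
        simp only [Equiv.symm_apply_apply]
        by_cases hi : i = i'
        · subst hi
          exact (hF i).2.1 j j' fun hj => hxy (by rw [hj])
        · exact (hdisj i i' hi).mono ((hF i).1 j).1 ((hF i').1 j').1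
      · rw [(hF _).2.2 _ ⟨0, ha⟩, (hF (finProdFinEquiv.symm y).1).2.2 _ ⟨0, ha⟩, ← hc', ← hc']
        exact hcol _ _
    · have := Set.ncard_le_ncard_of_injOn (s := {x | x ∈ S ∧ f' x = b}) (t := Set.univ)
        (fun x => (g b.1 x).1) (fun _ _ => Set.mem_univ _) (by
          rintro x ⟨hx, rfl⟩ y ⟨hy, hxy⟩ h
          simp only [f', Prod.mk.injEq] at hxy h
          refine hg (f x) ⟨hx, rfl⟩ ⟨hy, hxy.1⟩ (Prod.ext h ?_)
          rw [← hxy.2, hxy.1])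
      simpa using this
    · have h := hGood A hA hcard hinj
      obtain ⟨h1, -, -⟩ := h.choose_spec
      simp only [c', dif_pos h]
      exact hc _ ((h1 _).1.trans hA) (h1 _).2.1 (h1 _).2.2
    · obtain ⟨a, rfl⟩ := Nat.exists_eq_add_one.2 ha
      obtain ⟨q, rfl⟩ := Nat.exists_eq_add_one.2 hp.pos
      have e : (q + 1) * (a + 1) - 1 = q * a + q + a := by
        have : (q + 1) * (a + 1) = q * a + q + a + 1 := by ring
        omega
      rw [e] at hS
      simp only [Nat.add_sub_cancel]
      refine le_trans (le_of_eq ?_) hS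
      ring

end GeneralCase

section Kneser

variable {n k l r : ℕ} {P : Fin l → Finset (Fin n)}

lemma le_hypChromatic {V : Type*} {E : Set (Multiset V)} {N : ℕ}
    (h : ∀ t (c : V → Fin t), IsProperColoring E c → N ≤ t) : (N : ℕ∞) ≤ hypChromatic E := by
  refine le_sInf ?_
  rintro _ ⟨t, rfl, c, hc⟩
  exact_mod_cast h t c hc

/-- A proper coloring of `KG^r(n,k,P)` has at least the expected number of colors. -/
lemma le_of_isProperColoring (hk : 1 ≤ k) (hP : IsPartition n l P) (hPr : ∀ j, (P j).card ≤ r)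
    {t : ℕ} (c : KGPVertex n k l P → Fin t) (hc : IsProperColoring (KGPEdges n k l r P) c) :
    n - r * (k - 1) ≤ (r - 1) * t := by
  classical
  by_contra! hlt
  choose f hf hfu using hP.2
  have hmem (x : Fin n) (j : Fin l) : f x = j ↔ x ∈ P j :=
    ⟨fun h => h ▸ hf x, fun h => (hfu x j h).symm⟩
  have hvert (A : Finset (Fin n)) (hA : Set.InjOn f A) (j : Fin l) : (A ∩ P j).card ≤ 1 := by
    refine Finset.card_le_one.2 fun x hx y hy => ?_
    rw [Finset.mem_inter, ← hmem] at hx hy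
    exact hA hx.1 hy.1 (hx.2.trans hy.2.symm)
  let c' (A : Finset (Fin n)) : ℕ :=
    if h : A.card = k ∧ ∀ j, (A ∩ P j).card ≤ 1 then c ⟨A, h⟩ else 0
  have main := exists_monochromatic r f Finset.univ (fun j => ?_) c' k t
    (fun A _ hA hinj => ?_) ?_
  · obtain ⟨F, hF, hdisj, hcol⟩ := main
    let G (i : Fin r) : KGPVertex n k l P := ⟨F i, (hF i).2.1, hvert _ (hF i).2.2⟩
    have hG : Function.Injective G := by
      intro i j hij
      by_contra hne
      have h1 := hdisj i j hne
      rw [← show F i = F j from congrArg Subtype.val hij, disjoint_self] at h1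
      have h2 := (hF i).2.1
      rw [h1] at h2
      simp at h2
      omega
    obtain ⟨a, ha, b, hb, hab⟩ := hc (Finset.univ.val.map G) ⟨by simp,
      Finset.univ.nodup.map hG, fun a ha b hb hab => by
        simp only [Multiset.mem_map] at ha hb
        obtain ⟨i, -, rfl⟩ := ha
        obtain ⟨j, -, rfl⟩ := hb
        exact hdisj i j fun h => hab (h ▸ rfl)⟩
    simp only [Multiset.mem_map] at ha hb
    obtain ⟨i, -, rfl⟩ := ha
    obtain ⟨j, -, rfl⟩ := hb
    have hcG (i : Fin r) : c' (F i) = c (G i) := dif_pos _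
    exact hab (Fin.ext (by rw [← hcG, ← hcG, hcol i j]))
  · have : {x | x ∈ Finset.univ ∧ f x = j} = (P j : Set (Fin n)) := by
      ext x; simp [hmem]
    rw [this, Set.ncard_coe_finset]
    exact hPr j
  · simp only [c', dif_pos (show A.card = k ∧ ∀ j, (A ∩ P j).card ≤ 1 from ⟨hA, hvert A hinj⟩)]
    exact Fin.is_lt _
  · rw [mul_comm t, Finset.card_univ, Fintype.card_fin]
    omega

/-- The coloring by blocks of `r - 1` consecutive least elements. -/
lemma exists_isProperColoring (hk : 1 ≤ k) (hr : 2 ≤ r) {t : ℕ} (ht : 1 ≤ t)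
    (h : n - r * (k - 1) ≤ (r - 1) * t) :
    ∃ c : KGPVertex n k l P → Fin t, IsProperColoring (KGPEdges n k l r P) c := by
  classical
  have hmin (A : KGPVertex n k l P) : ∃ x ∈ A.1, ∀ y ∈ A.1, x ≤ y :=
    A.1.exists_min_image id (Finset.card_pos.1 (by rw [A.2.1]; omega))
  choose m hm hle using hmin
  refine ⟨fun A => ⟨min ((m A : ℕ) / (r - 1)) (t - 1), by omega⟩, ?_⟩
  rintro e ⟨hcard, hnodup, hdisj⟩
  by_contra! hsame
  simp only [Fin.mk.injEq] at hsame
  let E : Finset (KGPVertex n k l P) := ⟨e, hnodup⟩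
  have hE : E.card = r := hcard
  have hr0 : 0 < r - 1 := by omega
  by_cases hq : ∃ A ∈ e, (m A : ℕ) / (r - 1) < t - 1
  · obtain ⟨A, hA, hAq⟩ := hq
    have hmaps : ∀ B ∈ E, (m B : ℕ) ∈
        Finset.Ico ((r - 1) * ((m A : ℕ) / (r - 1)))
          ((r - 1) * ((m A : ℕ) / (r - 1)) + (r - 1)) := by
      intro B hB
      have hBA : (m B : ℕ) / (r - 1) = (m A : ℕ) / (r - 1) := by
        have := hsame A hA B hB
        omega
      rw [← hBA, Finset.mem_Ico]
      exact ⟨Nat.mul_div_le _ _, Nat.lt_mul_div_succ _ hr0⟩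
    have hinj : Set.InjOn (fun B => (m B : ℕ)) E := by
      intro B hB C hC hBC
      by_contra hne
      refine Finset.disjoint_left.1 (hdisj B hB C hC hne) (hm B) ?_
      rw [Fin.ext hBC]
      exact hm C
    have := Finset.card_le_card_of_injOn _ hmaps hinj
    rw [hE, Nat.card_Ico] at this
    omega
  · push Not at hq
    have hsub : (E.biUnion fun A => A.1.map Fin.valEmbedding) ⊆
        Finset.Ico ((t - 1) * (r - 1)) n := by
      intro x hx
      simp only [Finset.mem_biUnion, Finset.mem_map] at hx
      obtain ⟨A, hA, y, hy, rfl⟩ := hx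
      have h1 := (Nat.le_div_iff_mul_le hr0).1 (hq A hA)
      have h2 : (m A : ℕ) ≤ y := hle A y hy
      exact Finset.mem_Ico.2 ⟨h1.trans h2, y.2⟩
    have hc := Finset.card_le_card hsub
    rw [Finset.card_biUnion (fun A hA B hB hAB => by
      simpa using hdisj A hA B hB hAB), Finset.sum_congr rfl (g := fun _ => k)
      (fun A _ => by rw [Finset.card_map, A.2.1])] at hc
    rw [Finset.sum_const, hE, smul_eq_mul, Nat.card_Ico] at hc
    obtain ⟨t, rfl⟩ := Nat.exists_eq_add_one.2 ht
    obtain ⟨s, rfl⟩ := Nat.exists_eq_add_one.2 (show 0 < r by omega)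
    obtain ⟨k, rfl⟩ := Nat.exists_eq_add_one.2 hk
    simp only [Nat.add_sub_cancel] at h hc
    have e1 : s * (t + 1) = t * s + s := by ring
    have e2 : (s + 1) * (k + 1) = (s + 1) * k + s + 1 := by ring
    omega

end Kneser

theorem chromatic_KGP_eq (n k l r : ℕ) (P : Fin l → Finset (Fin n))
    (hk : 1 ≤ k) (hr : 2 ≤ r) (hn : r * k ≤ n)
    (hP : IsPartition n l P) (hPr : ∀ j, (P j).card ≤ r) :
    hypChromatic (KGPEdges n k l r P) = ((n - r * (k - 1)) ⌈/⌉ (r - 1) : ℕ) := by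
  have hr0 : 0 < r - 1 := by omega
  have hpos : 0 < n - r * (k - 1) := by
    have : r * (k - 1) < r * k := Nat.mul_lt_mul_of_pos_left (by omega) (by omega)
    omega
  refine le_antisymm (sInf_le ⟨_, rfl, ?_⟩) (le_hypChromatic fun t c hc => ?_)
  · have h := le_smul_ceilDiv (b := n - r * (k - 1)) hr0
    refine exists_isProperColoring hk hr (Nat.pos_of_ne_zero fun h0 => ?_) h
    rw [h0, smul_zero] at h
    omega
  · exact (ceilDiv_le_iff_le_mul hr0).2 (le_of_isProperColoring hk hP hPr c hc)
end

section
/- If s divides r - 1, 1 ≤ s < r, and ns ≥ rk, then the chromatic number of KG^r_S(n,k) with S = (s, s, ..., s) equals ⌈(ns - r(k-1))/(r-1)⌉. -/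
open Finset

/-- Vertices of `KG^r_S(n,k)`: the `k`-subsets of `[n]`. -/
def KGSVertex (n k : ℕ) : Type :=
  {A : Finset (Fin n) // A.card = k}

/-- Edges of `KG^r_S(n,k)`: multisets `{A_1, …, A_r}` of `k`-subsets that are `S`-disjoint,
i.e. each `i ∈ [n]` belongs to at most `s i` of the sets. -/
def KGSEdges (n k r : ℕ) (s : Fin n → ℕ) : Set (Multiset (KGSVertex n k)) :=
  {e | Multiset.card e = r ∧ ∀ x : Fin n, (e.filter fun A => x ∈ A.1).card ≤ s x}

/-- Words in signed letters `(sign, level)`, with signs in `ℤ/p`. -/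
abbrev SignedWord (p : ℕ) : Type := List (ZMod p × ℕ)

namespace SignedWord

variable {p : ℕ}

/-- The cyclic shift of the sign of a letter. -/
def rotLetter (p : ℕ) : ZMod p × ℕ ≃ ZMod p × ℕ :=
  (Equiv.addRight (1 : ZMod p)).prodCongr (Equiv.refl ℕ)

@[simp] lemma rotLetter_fst (a : ZMod p × ℕ) : (rotLetter p a).1 = a.1 + 1 := rfl
@[simp] lemma rotLetter_snd (a : ZMod p × ℕ) : (rotLetter p a).2 = a.2 := rfl

/-- The simultaneous cyclic shift of all signs of a word. -/
def rot (w : SignedWord p) : SignedWord p := w.map (rotLetter p)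

@[simp] lemma rot_nil : rot ([] : SignedWord p) = [] := rfl
@[simp] lemma rot_cons (a : ZMod p × ℕ) (w : SignedWord p) :
    rot (a :: w) = rotLetter p a :: rot w := rfl

/-- Integral chains on words. -/
abbrev Chain (p : ℕ) : Type := SignedWord p →₀ ℤ

/-- The chain consisting of a single word. -/
noncomputable abbrev word (w : SignedWord p) : Chain p := Finsupp.single w 1

/-- Chains supported on a given set of words. -/
noncomputable abbrev chainsOn (S : Set (SignedWord p)) : Submodule ℤ (Chain p) :=
  Finsupp.supported ℤ ℤ S

lemma word_mem {S : Set (SignedWord p)} {w : SignedWord p} (h : w ∈ S) : word w ∈ chainsOn S :=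
  Finsupp.single_mem_supported ℤ 1 h

lemma chainsOn_mono {S T : Set (SignedWord p)} {c : Chain p} (hc : c ∈ chainsOn S)
    (h : ∀ w ∈ S, w ∈ T) : c ∈ chainsOn T := Finsupp.supported_mono h hc

lemma map_mem_of_words {S : Set (SignedWord p)} {P : Submodule ℤ (Chain p)}
    (f : Chain p →ₗ[ℤ] Chain p) (h : ∀ w ∈ S, f (word w) ∈ P) {c : Chain p}
    (hc : c ∈ chainsOn S) : f c ∈ P := by
  rw [chainsOn, Finsupp.supported_eq_span_single] at hc
  have : Submodule.span ℤ ((fun i ↦ Finsupp.single i (1 : ℤ)) '' S) ≤ P.comap f := by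
    rw [Submodule.span_le]
    rintro _ ⟨w, hw, rfl⟩
    exact h w hw
  exact this hc

lemma eq_of_words {S : Set (SignedWord p)} {f f' : Chain p →ₗ[ℤ] Chain p}
    (h : ∀ w ∈ S, f (word w) = f' (word w)) {c : Chain p} (hc : c ∈ chainsOn S) :
    f c = f' c := by
  have := map_mem_of_words (P := ⊥) (f - f') (fun w hw => by simp [h w hw]) hc
  simpa [sub_eq_zero] using this

lemma hom_ext {f f' : Chain p →ₗ[ℤ] Chain p} (h : ∀ w, f (word w) = f' (word w)) : f = f' :=
  Finsupp.lhom_ext' fun w => LinearMap.ext_ring (h w)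

/-- Prepending a letter. -/
noncomputable def cons (a : ZMod p × ℕ) : Chain p →ₗ[ℤ] Chain p :=
  Finsupp.linearCombination ℤ fun w => word (a :: w)

/-- The shift action on chains. -/
noncomputable def shift (p : ℕ) : Module.End ℤ (Chain p) :=
  Finsupp.linearCombination ℤ fun w => word (rot w)

/-- The alternating sum of the words obtained by deleting a letter. -/
noncomputable def faces : SignedWord p → Chain p
  | [] => 0
  | a :: w => word w - cons a (faces w)

/-- The boundary operator of the reduced chain complex of words. -/
noncomputable def bdry (p : ℕ) : Chain p →ₗ[ℤ] Chain p := Finsupp.linearCombination ℤ faces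

/-- Prepending a letter, where words starting with that letter are sent to zero. -/
noncomputable def star (a : ZMod p × ℕ) : Chain p →ₗ[ℤ] Chain p :=
  Finsupp.linearCombination ℤ fun w => if w.head? = some a then 0 else word (a :: w)

@[simp] lemma cons_word (a : ZMod p × ℕ) (w : SignedWord p) :
    cons a (word w) = word (a :: w) := by simp [cons]
@[simp] lemma shift_word (w : SignedWord p) : shift p (word w) = word (rot w) := by simp [shift]
@[simp] lemma bdry_word (w : SignedWord p) : bdry p (word w) = faces w := by simp [bdry]
lemma star_word (a : ZMod p × ℕ) (w : SignedWord p) :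
    star a (word w) = if w.head? = some a then 0 else word (a :: w) := by simp [star]

lemma bdry_cons (a : ZMod p × ℕ) (c : Chain p) :
    bdry p (cons a c) = c - cons a (bdry p c) := by
  have : bdry p ∘ₗ cons a = LinearMap.id - cons a ∘ₗ bdry p :=
    hom_ext fun w => by simp [faces]
  exact LinearMap.congr_fun this c

lemma bdry_faces (w : SignedWord p) : bdry p (faces w) = 0 := by
  induction w with
  | nil => simp [faces]
  | cons a w ih => simp [faces, bdry_cons, ih]

lemma bdry_bdry (c : Chain p) : bdry p (bdry p c) = 0 := by
  have : bdry p ∘ₗ bdry p = 0 := hom_ext fun w => by simp [bdry_faces]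
  exact LinearMap.congr_fun this c

lemma shift_cons (a : ZMod p × ℕ) (c : Chain p) :
    shift p (cons a c) = cons (rotLetter p a) (shift p c) := by
  have : shift p ∘ₗ cons a = cons (rotLetter p a) ∘ₗ shift p :=
    hom_ext fun w => by simp
  exact LinearMap.congr_fun this c

lemma shift_faces (w : SignedWord p) : shift p (faces w) = faces (rot w) := by
  induction w with
  | nil => simp [faces]
  | cons a w ih => simp [faces, shift_cons, ih]

lemma commute_bdry_shift : Commute (bdry p : Module.End ℤ (Chain p)) (shift p) :=
  hom_ext fun w => by simp [shift_faces]

lemma shift_star (a : ZMod p × ℕ) (c : Chain p) :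
    shift p (star a c) = star (rotLetter p a) (shift p c) := by
  have : shift p ∘ₗ star a = star (rotLetter p a) ∘ₗ shift p :=
    hom_ext fun w => by
      rcases w with _ | ⟨b, w⟩
      · simp [star_word]
      · by_cases h : b = a <;> simp [star_word, h]
  exact LinearMap.congr_fun this c

lemma shift_pow_word (j : ℕ) (w : SignedWord p) :
    (shift p ^ j) (word w) = word (w.map fun a => (a.1 + (j : ZMod p), a.2)) := by
  induction j with
  | zero => simp
  | succ j ih =>
    rw [pow_succ', Module.End.mul_apply, ih, shift_word, rot, List.map_map]
    congr 2
    funext a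
    apply Prod.ext <;> simp [add_assoc]

lemma shift_pow_card : shift p ^ p = 1 :=
  hom_ext fun w => by rw [shift_pow_word]; simp

lemma faces_mem (w : SignedWord p) :
    faces w ∈ chainsOn {u | u.Sublist w ∧ u.length + 1 = w.length} := by
  induction w with
  | nil => simp [faces]
  | cons a w ih =>
    refine Submodule.sub_mem _ (word_mem (by simp)) ?_
    refine map_mem_of_words _ (fun u hu => ?_) ih
    rw [cons_word]
    exact word_mem ⟨hu.1.cons_cons a, by simp [← hu.2]⟩

/-- Words of a given length. -/
def ofLength (p n : ℕ) : Set (SignedWord p) := {w | w.length = n}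

lemma bdry_mem {n : ℕ} {c : Chain p} (hc : c ∈ chainsOn (ofLength p (n + 1))) :
    bdry p c ∈ chainsOn (ofLength p n) := by
  refine map_mem_of_words _ (fun w hw => ?_) hc
  rw [bdry_word]
  refine chainsOn_mono (faces_mem w) (fun u hu => ?_)
  have := hu.2
  simp only [ofLength, Set.mem_ofPred_eq] at hw ⊢
  omega

lemma shift_mem {n : ℕ} {c : Chain p} (hc : c ∈ chainsOn (ofLength p n)) :
    shift p c ∈ chainsOn (ofLength p n) := by
  refine map_mem_of_words _ (fun w hw => ?_) hc
  rw [shift_word]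
  exact word_mem (by simpa [ofLength, rot] using hw)

lemma shift_pow_mem {n : ℕ} {c : Chain p} (hc : c ∈ chainsOn (ofLength p n)) (j : ℕ) :
    (shift p ^ j) c ∈ chainsOn (ofLength p n) := by
  induction j with
  | zero => simpa
  | succ j ih => rw [pow_succ', Module.End.mul_apply]; exact shift_mem ih

/-- The projection to the words whose first letter has sign `0`. -/
noncomputable def headZero (p : ℕ) : Module.End ℤ (Chain p) :=
  Finsupp.linearCombination ℤ fun w =>
    if w.head?.map Prod.fst = some 0 then word w else 0

lemma headZero_word (w : SignedWord p) :
    headZero p (word w) = if w.head?.map Prod.fst = some 0 then word w else 0 := by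
  simp [headZero]

lemma headZero_mem {n : ℕ} {c : Chain p} (hc : c ∈ chainsOn (ofLength p n)) :
    headZero p c ∈ chainsOn (ofLength p n) := by
  refine map_mem_of_words _ (fun w hw => ?_) hc
  rw [headZero_word]
  split_ifs
  · exact word_mem hw
  · exact Submodule.zero_mem _

lemma sum_headZero [NeZero p] {n : ℕ} {c : Chain p} (hc : c ∈ chainsOn (ofLength p (n + 1))) :
    ∑ j ∈ range p, (shift p ^ j) (headZero p ((shift p ^ (p - j)) c)) = c := by
  have key := eq_of_words (f := ∑ j ∈ range p, shift p ^ j * headZero p * shift p ^ (p - j))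
    (f' := LinearMap.id) (S := ofLength p (n + 1)) (fun w hw => ?_) hc
  · simpa [LinearMap.sum_apply, mul_assoc] using key
  rcases w with _ | ⟨a, w⟩
  · simp [ofLength] at hw
  simp only [LinearMap.sum_apply, LinearMap.id_apply]
  rw [Finset.sum_eq_single (a.1.val)]
  · have h1 : a.1.val ≤ p := (ZMod.val_lt a.1).le
    have h2 : a.1 + ((p - a.1.val : ℕ) : ZMod p) = 0 := by
      rw [Nat.cast_sub h1]; simp
    rw [Module.End.mul_apply, Module.End.mul_apply, shift_pow_word, headZero_word, if_pos]
    · rw [← shift_pow_word, ← Module.End.mul_apply, ← pow_add, Nat.add_sub_cancel' h1,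
        shift_pow_card]; rfl
    · simpa using h2
  · intro j hj hne
    have hj' := mem_range.1 hj
    rw [Module.End.mul_apply, Module.End.mul_apply, shift_pow_word, headZero_word, if_neg, map_zero]
    simp only [List.map_cons, List.head?_cons, Option.map_some, Option.some.injEq]
    rw [Nat.cast_sub hj'.le]
    intro h
    apply hne
    have : a.1 = (j : ZMod p) := by
      have := h; simp at this; linear_combination this
    rw [this, ZMod.val_cast_of_lt hj']
  · intro h
    exact absurd (mem_range.2 (ZMod.val_lt a.1)) h

/-- The differentials of the periodic resolution of the cyclic group: the norm element in even
degrees, and the augmentation element in odd degrees. -/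
noncomputable def periodic (p i : ℕ) : Module.End ℤ (Chain p) :=
  if Even i then ∑ j ∈ range p, shift p ^ j else shift p - 1

lemma periodic_mul_succ (i : ℕ) : periodic p i * periodic p (i + 1) = 0 := by
  unfold periodic
  by_cases h : Even i
  · rw [if_pos h, if_neg (by simpa [Nat.even_add_one] using h), geom_sum_mul, shift_pow_card,
      sub_self]
  · rw [if_neg h, if_pos (by simpa [Nat.even_add_one] using h), mul_geom_sum, shift_pow_card,
      sub_self]

lemma commute_bdry_periodic (i : ℕ) :
    Commute (bdry p : Module.End ℤ (Chain p)) (periodic p i) := by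
  unfold periodic
  split_ifs
  · exact Commute.sum_right _ _ _ fun j _ => commute_bdry_shift.pow_right j
  · exact commute_bdry_shift.sub_right (Commute.one_right _)

lemma exists_periodic_eq [NeZero p] {n i : ℕ} {c : Chain p}
    (hc : c ∈ chainsOn (ofLength p (n + 1))) (h : periodic p (i + 1) c = 0) :
    ∃ y ∈ chainsOn (ofLength p (n + 1)), periodic p i y = c := by
  have hsum := sum_headZero hc
  by_cases hi : Even i
  · have hfix : shift p c = c := by
      rw [periodic, if_neg (by simpa [Nat.even_add_one] using hi)] at h
      simpa [sub_eq_zero] using h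
    have hpow (j : ℕ) : (shift p ^ j) c = c := by
      induction j with
      | zero => simp
      | succ j ih => rw [pow_succ', Module.End.mul_apply, ih, hfix]
    refine ⟨headZero p c, headZero_mem hc, ?_⟩
    rw [periodic, if_pos hi, LinearMap.sum_apply]
    simpa [hpow] using hsum
  · rw [periodic, if_pos (by simpa [Nat.even_add_one] using hi), LinearMap.sum_apply] at h
    set d : ℕ → Chain p := fun j => headZero p ((shift p ^ (p - j)) c) with hd
    have hd0 : ∑ j ∈ range p, d j = 0 := by
      have hp : ∑ j ∈ range p, (shift p ^ (p - j)) c = ∑ j ∈ range p, (shift p ^ j) c := by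
        rw [← Finset.sum_range_reflect, ← sub_eq_zero, ← Finset.sum_sub_distrib]
        have := Finset.sum_range_sub (fun j => (shift p ^ j) c) p
        rw [shift_pow_card] at this
        rw [show (0 : Chain p) = (1 : Module.End ℤ (Chain p)) c - (shift p ^ 0) c by simp, ← this]
        refine Finset.sum_congr rfl fun j hj => ?_
        have := mem_range.1 hj
        rw [show p - (p - 1 - j) = j + 1 by omega]
      rw [hd, ← map_sum, hp, h, map_zero]
    refine ⟨∑ j ∈ range p, (∑ l ∈ range j, shift p ^ l) (d j), ?_, ?_⟩
    · refine Submodule.sum_mem _ fun j _ => ?_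
      rw [LinearMap.sum_apply]
      exact Submodule.sum_mem _ fun l _ => shift_pow_mem (headZero_mem (shift_pow_mem hc _)) l
    · rw [periodic, if_neg hi, map_sum]
      simp_rw [← Module.End.mul_apply, mul_geom_sum]
      simp only [LinearMap.sub_apply, Module.End.one_apply]
      rw [Finset.sum_sub_distrib, hd0, sub_zero]
      exact hsum


/-- Words with strictly decreasing levels, all of them below `N`. -/
def good (p N : ℕ) : Set (SignedWord p) :=
  {w | w.Pairwise (fun a b => b.2 < a.2) ∧ ∀ a ∈ w, a.2 < N}

lemma good_sublist {N : ℕ} {u w : SignedWord p} (h : u.Sublist w) (hw : w ∈ good p N) :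
    u ∈ good p N :=
  ⟨hw.1.sublist h, fun a ha => hw.2 a (h.subset ha)⟩

lemma length_le_of_good {N : ℕ} {w : SignedWord p} (hw : w ∈ good p N) : w.length ≤ N := by
  have hnd : (w.map Prod.snd).Nodup := by
    rw [List.Nodup, List.pairwise_map]
    exact hw.1.imp fun h => h.ne'
  have : (w.map Prod.snd).toFinset ⊆ range N := by
    intro i hi
    simp only [List.mem_toFinset, List.mem_map] at hi
    obtain ⟨a, ha, rfl⟩ := hi
    exact mem_range.2 (hw.2 a ha)
  have := card_le_card this
  rwa [List.toFinset_card_of_nodup hnd, List.length_map, card_range] at this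

lemma bdry_star_word {N : ℕ} {a : ZMod p × ℕ} {w : SignedWord p}
    (h : a :: w ∈ good p N ∨ ∃ l, w = a :: l ∧ w ∈ good p N) :
    bdry p (star a (word w)) = word w - star a (bdry p (word w)) := by
  have hstar {u : SignedWord p} (hu : a :: u ∈ good p N) : star a (word u) = cons a (word u) := by
    rw [star_word, if_neg, cons_word]
    intro hh
    obtain ⟨l, rfl⟩ : ∃ l, u = a :: l := by
      cases u <;> simp_all
    have := List.rel_of_pairwise_cons hu.1 (List.mem_cons_self)
    exact lt_irrefl _ this
  have hfaces {u : SignedWord p} (hu : a :: u ∈ good p N) :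
      star a (faces u) = cons a (faces u) :=
    eq_of_words (fun v hv => hstar (good_sublist (hv.1.cons_cons a) hu)) (faces_mem u)
  rcases h with h | ⟨l, rfl, h⟩
  · rw [hstar h, bdry_word, hfaces h, cons_word, bdry_word, faces]
  · rw [star_word, if_pos (by simp), map_zero, bdry_word, faces, map_sub, hstar h, cons_word]
    have : star a (cons a (faces l)) = 0 := by
      have h0 : star a ∘ₗ cons a = 0 := hom_ext fun u => by simp [star_word]
      exact LinearMap.congr_fun h0 _
    rw [this]
    simp

/-- The chain map induced by a labelling of the barycentric subdivision: in degree `n` it sends a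
word of length `n` to the image of its subdivision. -/
noncomputable def subdiv (μ : SignedWord p → ZMod p × ℕ) : ℕ → (Chain p →ₗ[ℤ] Chain p)
  | 0 => LinearMap.id
  | n + 1 => Finsupp.linearCombination ℤ fun w => star (μ w) (subdiv μ n (faces w))

lemma subdiv_succ_word (μ : SignedWord p → ZMod p × ℕ) (n : ℕ) (w : SignedWord p) :
    subdiv μ (n + 1) (word w) = star (μ w) (subdiv μ n (faces w)) := by
  simp [subdiv]

/-- Labellings of good words by signed letters which are monotone in the level, equivariant, and
whose sign is determined along chains of equal level. -/
structure IsLabelling (N M : ℕ) (μ : SignedWord p → ZMod p × ℕ) : Prop where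
  lt : ∀ w ∈ good p N, w ≠ [] → (μ w).2 < M
  mono : ∀ u w : SignedWord p, u.Sublist w → w ∈ good p N → u ≠ [] → (μ u).2 ≤ (μ w).2
  eq_of_eq : ∀ u w : SignedWord p, u.Sublist w → w ∈ good p N → u ≠ [] →
    (μ u).2 = (μ w).2 → μ u = μ w
  rot : ∀ w ∈ good p N, w ≠ [] → μ (rot w) = rotLetter p (μ w)

section Labelling

variable {N M : ℕ} {μ : SignedWord p → ZMod p × ℕ}

lemma IsLabelling.compatible (hμ : IsLabelling N M μ) {u w : SignedWord p} (hw : w ∈ good p N)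
    (hne : w ≠ []) {n : ℕ} (hu : u ∈ {u : SignedWord p | u ∈ good p M ∧ u.length = n ∧
      (n = 0 ∨ ∃ v l, v ≠ [] ∧ v.Sublist w ∧ u = μ v :: l)}) :
    μ w :: u ∈ good p M ∨ ∃ l, u = μ w :: l ∧ u ∈ good p M := by
  obtain ⟨hgood, hlen, hu⟩ := hu
  have hlt := hμ.lt w hw hne
  rcases hu with rfl | ⟨v, l, hv, hvw, rfl⟩
  · left
    rw [List.length_eq_zero_iff] at hlen
    subst hlen
    exact ⟨List.pairwise_singleton _ _, by simpa only [List.forall_mem_singleton] using hlt⟩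
  · rcases (hμ.mono v w hvw hw hv).eq_or_lt with h | h
    · right
      rw [hμ.eq_of_eq v w hvw hw hv h] at hgood ⊢
      exact ⟨l, rfl, hgood⟩
    · left
      refine ⟨List.pairwise_cons.2 ⟨fun b hb => ?_, hgood.1⟩, ?_⟩
      · rcases List.mem_cons.1 hb with rfl | hb
        · exact h
        · exact (List.rel_of_pairwise_cons hgood.1 hb).trans h
      · intro b hb
        rcases List.mem_cons.1 hb with rfl | hb
        · exact hlt
        · exact hgood.2 b hb

lemma subdiv_faces_mem {n : ℕ}
    (h : ∀ w ∈ good p N, w.length = n → subdiv μ n (word w) ∈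
      chainsOn {u : SignedWord p | u ∈ good p M ∧ u.length = n ∧ (n = 0 ∨ ∃ l, u = μ w :: l)})
    {w : SignedWord p}
    (hw : w ∈ good p N) (hlen : w.length = n + 1) : subdiv μ n (faces w) ∈
      chainsOn {u : SignedWord p | u ∈ good p M ∧ u.length = n ∧
        (n = 0 ∨ ∃ v l, v ≠ [] ∧ v.Sublist w ∧ u = μ v :: l)} := by
  refine map_mem_of_words _ (fun v hv => ?_) (faces_mem w)
  have hvn : v.length = n := by have := hv.2; omega
  refine chainsOn_mono (h v (good_sublist hv.1 hw) hvn)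
    (fun u hu => ⟨hu.1, hu.2.1, ?_⟩)
  rcases hu.2.2 with h | ⟨l, h⟩
  · exact Or.inl h
  · by_cases hn : n = 0
    · exact Or.inl hn
    · refine Or.inr ⟨v, l, ?_, hv.1, h⟩
      rintro rfl
      exact hn hvn.symm

lemma IsLabelling.subdiv_word_mem (hμ : IsLabelling N M μ) (n : ℕ) :
    ∀ w ∈ good p N, w.length = n → subdiv μ n (word w) ∈
      chainsOn {u : SignedWord p | u ∈ good p M ∧ u.length = n ∧
        (n = 0 ∨ ∃ l, u = μ w :: l)} := by
  induction n with
  | zero =>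
    intro w _ hlen
    rw [List.length_eq_zero_iff] at hlen
    subst hlen
    exact word_mem (by simp [good])
  | succ n ih =>
    intro w hw hlen
    have hne : w ≠ [] := by rintro rfl; simp at hlen
    rw [subdiv_succ_word]
    have hmem := subdiv_faces_mem ih hw hlen
    refine map_mem_of_words _ (fun u hu => ?_) hmem
    rw [star_word]
    split_ifs with h
    · exact Submodule.zero_mem _
    · refine word_mem ⟨?_, by simp [hu.2.1], Or.inr ⟨u, rfl⟩⟩
      rcases hμ.compatible hw hne hu with h' | ⟨l, rfl, _⟩
      · exact h'
      · simp at h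

lemma faces_mem_good {n : ℕ} {w : SignedWord p} (hw : w ∈ good p N) (hlen : w.length = n + 1) :
    faces w ∈ chainsOn (good p N ∩ ofLength p n) := by
  refine chainsOn_mono (faces_mem w) (fun u hu => ⟨good_sublist hu.1 hw, ?_⟩)
  have := hu.2
  change u.length = n
  omega

lemma IsLabelling.bdry_subdiv_word (hμ : IsLabelling N M μ) (n : ℕ) :
    ∀ w ∈ good p N, w.length = n + 1 →
      bdry p (subdiv μ (n + 1) (word w)) = subdiv μ n (faces w) := by
  induction n with
  | zero =>
    intro w hw hlen
    obtain ⟨a, rfl⟩ := List.length_eq_one_iff.1 hlen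
    simp [faces, subdiv, star_word]
  | succ n ih =>
    intro w hw hlen
    have hne : w ≠ [] := by rintro rfl; simp at hlen
    have hstar : bdry p (star (μ w) (subdiv μ (n + 1) (faces w))) =
        subdiv μ (n + 1) (faces w) - star (μ w) (bdry p (subdiv μ (n + 1) (faces w))) :=
      eq_of_words (f := bdry p ∘ₗ star (μ w)) (f' := LinearMap.id - star (μ w) ∘ₗ bdry p)
        (fun u hu => bdry_star_word (hμ.compatible hw hne hu))
        (subdiv_faces_mem (hμ.subdiv_word_mem (n + 1)) hw hlen)
    have hzero : bdry p (subdiv μ (n + 1) (faces w)) = subdiv μ n (bdry p (faces w)) :=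
      eq_of_words (f := bdry p ∘ₗ subdiv μ (n + 1)) (f' := subdiv μ n ∘ₗ bdry p)
        (fun v hv => by simpa using ih v hv.1 hv.2) (faces_mem_good hw hlen)
    rw [subdiv_succ_word, hstar, hzero, bdry_faces]
    simp

lemma rot_mem_good {w : SignedWord p} (hw : w ∈ good p N) : rot w ∈ good p N := by
  refine ⟨?_, ?_⟩
  · rw [rot, List.pairwise_map]
    exact hw.1
  · intro a ha
    obtain ⟨b, hb, rfl⟩ := List.mem_map.1 ha
    exact hw.2 b hb

lemma IsLabelling.subdiv_shift_word (hμ : IsLabelling N M μ) (n : ℕ) :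
    ∀ w ∈ good p N, w.length = n →
      subdiv μ n (shift p (word w)) = shift p (subdiv μ n (word w)) := by
  induction n with
  | zero => intros; rfl
  | succ n ih =>
    intro w hw hlen
    have hne : w ≠ [] := by rintro rfl; simp at hlen
    rw [shift_word, subdiv_succ_word, subdiv_succ_word, hμ.rot w hw hne, shift_star,
      ← shift_faces]
    congr 1
    exact eq_of_words (f := subdiv μ n ∘ₗ shift p) (f' := shift p ∘ₗ subdiv μ n)
      (fun v hv => ih v hv.1 hv.2) (faces_mem_good hw hlen)

/-- Good words of length `n`. -/
abbrev goodOfLength (p N n : ℕ) : Set (SignedWord p) := good p N ∩ ofLength p n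

lemma IsLabelling.bdry_subdiv (hμ : IsLabelling N M μ) {n : ℕ} {c : Chain p}
    (hc : c ∈ chainsOn (goodOfLength p N (n + 1))) :
    bdry p (subdiv μ (n + 1) c) = subdiv μ n (bdry p c) :=
  eq_of_words (f := bdry p ∘ₗ subdiv μ (n + 1)) (f' := subdiv μ n ∘ₗ bdry p)
    (fun w hw => by simpa using hμ.bdry_subdiv_word n w hw.1 hw.2) hc

lemma IsLabelling.subdiv_mem (hμ : IsLabelling N M μ) {n : ℕ} {c : Chain p}
    (hc : c ∈ chainsOn (goodOfLength p N n)) :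
    subdiv μ n c ∈ chainsOn (goodOfLength p M n) := by
  refine map_mem_of_words _ (fun w hw => ?_) hc
  exact chainsOn_mono (hμ.subdiv_word_mem n w hw.1 hw.2) (fun _ hu => ⟨hu.1, hu.2.1⟩)

lemma shift_mem_good {n : ℕ} {c : Chain p} (hc : c ∈ chainsOn (goodOfLength p N n)) :
    shift p c ∈ chainsOn (goodOfLength p N n) := by
  refine map_mem_of_words _ (fun w hw => ?_) hc
  rw [shift_word]
  exact word_mem ⟨rot_mem_good hw.1, by simpa [ofLength, rot] using hw.2⟩

lemma shift_pow_mem_good {n : ℕ} {c : Chain p} (hc : c ∈ chainsOn (goodOfLength p N n)) (j : ℕ) :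
    (shift p ^ j) c ∈ chainsOn (goodOfLength p N n) := by
  induction j with
  | zero => simpa
  | succ j ih => rw [pow_succ', Module.End.mul_apply]; exact shift_mem_good ih

lemma periodic_mem_good {n : ℕ} (i : ℕ) {c : Chain p}
    (hc : c ∈ chainsOn (goodOfLength p N n)) :
    periodic p i c ∈ chainsOn (goodOfLength p N n) := by
  unfold periodic
  split_ifs
  · rw [LinearMap.sum_apply]
    exact Submodule.sum_mem _ fun j _ => shift_pow_mem_good hc j
  · exact Submodule.sub_mem _ (shift_mem_good hc) hc

lemma IsLabelling.subdiv_periodic (hμ : IsLabelling N M μ) {n : ℕ} (i : ℕ) {c : Chain p}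
    (hc : c ∈ chainsOn (goodOfLength p N n)) :
    subdiv μ n (periodic p i c) = periodic p i (subdiv μ n c) := by
  have hshift {d : Chain p} (hd : d ∈ chainsOn (goodOfLength p N n)) :
      subdiv μ n (shift p d) = shift p (subdiv μ n d) :=
    eq_of_words (f := subdiv μ n ∘ₗ shift p) (f' := shift p ∘ₗ subdiv μ n)
      (fun v hv => hμ.subdiv_shift_word n v hv.1 hv.2) hd
  unfold periodic
  split_ifs
  · rw [LinearMap.sum_apply, LinearMap.sum_apply, map_sum]
    refine Finset.sum_congr rfl fun j hj => ?_
    clear hj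
    induction j with
    | zero => simp
    | succ j ih =>
      rw [pow_succ', Module.End.mul_apply, Module.End.mul_apply,
        hshift (shift_pow_mem_good hc j), ih]
  · simp [hshift hc]

/-- A sequence of chains resolving the augmentation: the boundary of the chain in degree `i + 1`
is the image of the chain in degree `i` under the differential of the periodic resolution. -/
noncomputable def resolution (p : ℕ) : ℕ → Chain p
  | 0 => word [(0, 0)]
  | i + 1 => cons (0, i + 1) (periodic p (i + 1) (resolution p i))

lemma resolution_mem (i : ℕ) : resolution p i ∈ chainsOn (goodOfLength p (i + 1) (i + 1)) := by
  induction i with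
  | zero => exact word_mem (by simp [good, ofLength])
  | succ i ih =>
    refine map_mem_of_words _ (fun w hw => ?_) (periodic_mem_good (i + 1) ih)
    rw [cons_word]
    obtain ⟨⟨h1, h2⟩, h3⟩ := hw
    refine word_mem ⟨⟨List.pairwise_cons.2 ⟨fun b hb => h2 b hb, h1⟩, ?_⟩, ?_⟩
    · intro b hb
      rcases List.mem_cons.1 hb with rfl | hb
      · simp
      · exact (h2 b hb).trans (Nat.lt_succ_self _)
    · simpa [ofLength] using h3

lemma periodic_nil_one : periodic p 1 (word []) = 0 := by
  simp [periodic]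

lemma bdry_resolution_succ (i : ℕ) :
    bdry p (resolution p (i + 1)) = periodic p (i + 1) (resolution p i) := by
  have hcomm (i : ℕ) (c : Chain p) : bdry p (periodic p i c) = periodic p i (bdry p c) :=
    LinearMap.congr_fun (commute_bdry_periodic i) c
  induction i with
  | zero =>
    rw [show resolution p (0 + 1) = cons (0, 0 + 1) (periodic p (0 + 1) (resolution p 0)) from rfl,
      bdry_cons, hcomm]
    simp [resolution, faces, periodic_nil_one]
  | succ i ih =>
    rw [resolution, bdry_cons, hcomm, ih, ← Module.End.mul_apply (periodic p (i + 1 + 1))]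
    have : periodic p (i + 1 + 1) * periodic p (i + 1) =
        periodic p (i + 1) * periodic p (i + 2) := by
      unfold periodic
      split_ifs
      · rfl
      · exact (Commute.sum_left _ _ _ fun j _ =>
          ((Commute.refl (shift p)).pow_left j).sub_right (Commute.one_right _)).eq
      · exact (Commute.sum_right _ _ _ fun j _ =>
          ((Commute.refl (shift p)).pow_right j).sub_left (Commute.one_left _)).eq
      · rfl
    rw [this, periodic_mul_succ]
    simp

/-- A combinatorial form of Dold's theorem for the cyclic group of order `p`. -/
theorem IsLabelling.le [NeZero p] (hp : p ≠ 1) (hN : 0 < N) (hμ : IsLabelling N M μ) : N ≤ M := by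
  by_contra! hlt
  have hcomm (i : ℕ) (c : Chain p) : bdry p (periodic p i c) = periodic p i (bdry p c) :=
    LinearMap.congr_fun (commute_bdry_periodic i) c
  have hres {i : ℕ} (hi : i < N) : resolution p i ∈ chainsOn (goodOfLength p N (i + 1)) :=
    chainsOn_mono (resolution_mem i)
      (fun w hw => ⟨⟨hw.1.1, fun a ha => (hw.1.2 a ha).trans_le hi⟩, hw.2⟩)
  set Z : ℕ → Chain p := fun i => subdiv μ (i + 1) (resolution p i) with hZ
  have hZmem {i : ℕ} (hi : i < N) : Z i ∈ chainsOn (ofLength p (i + 1)) :=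
    chainsOn_mono (hμ.subdiv_mem (hres hi)) (fun _ hw => hw.2)
  have hbdry {i : ℕ} (hi : i + 1 < N) : bdry p (Z (i + 1)) = periodic p (i + 1) (Z i) := by
    rw [hZ]
    simp only
    rw [hμ.bdry_subdiv (hres hi), bdry_resolution_succ,
      hμ.subdiv_periodic _ (hres (Nat.lt_of_succ_lt hi))]
  have hZM : Z M = 0 := by
    have h := hμ.subdiv_mem (hres hlt)
    have hempty : goodOfLength p M (M + 1) = ∅ := by
      ext w
      simp only [Set.mem_inter_iff, Set.mem_empty_iff_false, iff_false, not_and]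
      intro h1 h2
      have h3 := length_le_of_good h1
      change w.length = M + 1 at h2
      omega
    rw [hempty, chainsOn, Finsupp.supported_empty] at h
    exact (Submodule.mem_bot ℤ).1 h
  have key (d : ℕ) : ∀ i, i + d = M → ∃ y ∈ chainsOn (ofLength p (i + 2)),
      ∃ y' ∈ chainsOn (ofLength p (i + 1)), Z i = bdry p y + periodic p i y' := by
    induction d with
    | zero =>
      rintro i rfl
      exact ⟨0, Submodule.zero_mem _, 0, Submodule.zero_mem _, by simpa using hZM⟩
    | succ d ih =>
      intro i hi
      obtain ⟨y, hy, y', hy', hZi⟩ := ih (i + 1) (by omega)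
      have h1 : periodic p (i + 1) (Z i - bdry p y') = 0 := by
        rw [map_sub, ← hbdry (by omega), hZi, map_add, bdry_bdry, hcomm, zero_add, sub_self]
      obtain ⟨z, hz, hzeq⟩ := exists_periodic_eq
        (Submodule.sub_mem _ (hZmem (by omega)) (bdry_mem hy')) h1
      exact ⟨y', hy', z, hz, by rw [hzeq]; abel⟩
  obtain ⟨y, -, y', hy', hZ0⟩ := key M 0 (zero_add M)
  have h0 : bdry p (Z 0) = word [] := by
    rw [hZ]
    simp only
    rw [hμ.bdry_subdiv (hres hN)]
    simp [resolution, faces, subdiv]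
  rw [hZ0, map_add, bdry_bdry, zero_add, hcomm] at h0
  have hfix : ∀ c ∈ chainsOn (ofLength p 0), periodic p 0 c = (p : ℤ) • c := fun c hc =>
    eq_of_words (f' := (p : ℤ) • LinearMap.id) (fun w hw => by
      obtain rfl : w = [] := List.length_eq_zero_iff.1 hw
      simp [periodic, LinearMap.sum_apply, shift_pow_word]) hc
  rw [hfix _ (bdry_mem hy')] at h0
  have h1 := DFunLike.congr_fun h0 []
  simp only [Finsupp.smul_apply, smul_eq_mul, Finsupp.single_eq_same] at h1
  have h2 : (p : ℤ) ∣ 1 := ⟨_, h1.symm⟩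
  exact hp (by exact_mod_cast Int.eq_one_of_dvd_one (by positivity) h2)

end Labelling

end SignedWord

/-- An equivariant choice of a sign for every non-constant function on `ℤ/p`. -/
lemma exists_equivariant_sign (p : ℕ) [Fact p.Prime] (β : Type*) :
    ∃ σ : (ZMod p → β) → ZMod p,
      ∀ f : ZMod p → β, (∃ a b, f a ≠ f b) → σ (fun j => f (j - 1)) = σ f + 1 := by
  let S : Setoid (ZMod p → β) :=
    { r := fun f f' => ∃ a : ZMod p, ∀ j, f j = f' (j - a)
      iseqv :=
        { refl := fun f => ⟨0, by simp⟩
          symm := fun {f f'} ⟨a, h⟩ => ⟨-a, fun j => by rw [h]; simp⟩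
          trans := fun {f f' f''} ⟨a, h⟩ ⟨b, h'⟩ =>
            ⟨a + b, fun j => by rw [h, h', sub_sub]⟩ } }
  have hout (f : ZMod p → β) : ∃ a : ZMod p, ∀ j, f j = (Quotient.mk S f).out (j - a) :=
    S.symm (Quotient.mk_out (s := S) f)
  choose σ hσ using hout
  refine ⟨σ, fun f hf => ?_⟩
  set f' : ZMod p → β := fun j => f (j - 1) with hf'
  have hq : Quotient.mk S f' = Quotient.mk S f := Quotient.sound (s := S) ⟨1, fun j => rfl⟩
  have h1 := hσ f'
  rw [hq] at h1
  have h2 := hσ f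
  set o := (Quotient.mk S f).out
  by_contra hne
  set d := σ f' - (σ f + 1) with hd
  have hd0 : d ≠ 0 := sub_ne_zero.2 hne
  have hper (j : ZMod p) : o (j + d) = o j := by
    have e1 := h1 (j + σ f')
    rw [hf'] at e1
    simp only at e1
    rw [h2] at e1
    rw [add_sub_cancel_right] at e1
    rw [← e1]
    congr 1
    rw [hd]
    ring
  have hmul (n : ℕ) : o (n * d) = o 0 := by
    induction n with
    | zero => simp
    | succ n ih => rw [← ih, ← hper (n * d)]; congr 1; push_cast; ring
  have hconst (j : ZMod p) : o j = o 0 := by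
    rw [← hmul (j / d).val, ZMod.natCast_zmod_val, div_mul_cancel₀ _ hd0]
  obtain ⟨a, b, hab⟩ := hf
  exact hab (by rw [h2, h2 b, hconst, hconst (b - _)])

lemma card_sum_le {α : Type*} {p k : ℕ} [NeZero p] {A : ZMod p → Finset α}
    (hA : ∀ j, #(A j) ≤ k - 1) : ∑ j, #(A j) ≤ p * (k - 1) := by
  have := sum_le_card_nsmul univ (fun j => #(A j)) (k - 1) fun j _ => hA j
  simpa [ZMod.card] using this

lemma card_sum_pos {α : Type*} {p : ℕ} [NeZero p] {A : ZMod p → Finset α}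
    (hne : ∃ j, (A j).Nonempty) : 0 < ∑ j, #(A j) := by
  obtain ⟨j, hj⟩ := hne
  exact sum_pos' (fun _ _ => Nat.zero_le _) ⟨j, mem_univ j, hj.card_pos⟩

section TopColor

variable {α : Type*} {p k t : ℕ} {c : Finset α → ℕ} {A A' : ZMod p → Finset α}

/-- The largest color below `t` of a `k`-set contained in a member of the family. -/
noncomputable def topColor (k t : ℕ) (c : Finset α → ℕ) (A : ZMod p → Finset α) : ℕ :=
  @Nat.findGreatest (fun i => ∃ j, ∃ B ⊆ A j, #B = k ∧ c B = i) (Classical.decPred _) t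

/-- The members of a family that contain a `k`-set of the top color. -/
def topClass (k t : ℕ) (c : Finset α → ℕ) (A : ZMod p → Finset α) (j : ZMod p) : Prop :=
  ∃ B ⊆ A j, #B = k ∧ c B = topColor k t c A

lemma topColor_lt (hk : 1 ≤ k) (hc : ∀ B, #B = k → c B < t)
    (hA : ¬ ∀ j, #(A j) ≤ k - 1) : topColor k t c A < t ∧ ∃ j, topClass k t c A j := by
  push Not at hA
  obtain ⟨j, hj⟩ := hA
  obtain ⟨B, hB, hBk⟩ := exists_subset_card_eq (show k ≤ #(A j) by omega)
  have hspec : ∃ j, topClass k t c A j :=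
    @Nat.findGreatest_spec _ (fun i => ∃ j, ∃ B ⊆ A j, #B = k ∧ c B = i) (Classical.decPred _) _
      (hc B hBk).le ⟨j, B, hB, hBk, rfl⟩
  obtain ⟨j', B', hB', hBk', hBc'⟩ := hspec
  refine ⟨?_, j', B', hB', hBk', hBc'⟩
  have := hc B' hBk'
  rw [hBc'] at this
  exact this

lemma topColor_mono (hk : 1 ≤ k) (hc : ∀ B, #B = k → c B < t) (hAA : ∀ j, A j ⊆ A' j)
    (hA : ¬ ∀ j, #(A j) ≤ k - 1) : topColor k t c A ≤ topColor k t c A' := by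
  obtain ⟨h, j, B, hB, hBk, hBc⟩ := topColor_lt hk hc hA
  exact @Nat.le_findGreatest _ (fun i => ∃ j, ∃ B ⊆ A' j, #B = k ∧ c B = i) (Classical.decPred _)
    _ h.le ⟨j, B, hB.trans (hAA j), hBk, hBc⟩

end TopColor

section Kneser

variable {α : Type*} [DecidableEq α]

/-- Some family of `k`-sets indexed by `ι` is monochromatic with respect to the coloring `c` and
covers each element `x` at most `w x` times. -/
def HasMonochromaticFamily (ι : Type*) [Fintype ι] (w : α → ℕ) (k : ℕ) (c : Finset α → ℕ) : Prop :=
  ∃ i, ∃ A : ι → Finset α, (∀ j, #(A j) = k ∧ c (A j) = i) ∧ ∀ x, #{j | x ∈ A j} ≤ w x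

lemma HasMonochromaticFamily.congr {ι κ : Type*} [Fintype ι] [Fintype κ] (e : κ ≃ ι) {w : α → ℕ}
    {k : ℕ} {c : Finset α → ℕ} (h : HasMonochromaticFamily ι w k c) :
    HasMonochromaticFamily κ w k c := by
  obtain ⟨i, A, hA, hw⟩ := h
  refine ⟨i, A ∘ e, fun j => hA (e j), fun x => ?_⟩
  refine (card_le_card_of_injOn e (fun j hj => ?_) e.injective.injOn).trans (hw x)
  simpa using hj

open Classical in
/-- Sarkaria's labelling of families of sets by signed letters. -/
noncomputable def familyLabel {p : ℕ} [NeZero p] (k t : ℕ) (c : Finset α → ℕ)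
    (σ : (ZMod p → Finset α) → ZMod p) (σ' : (ZMod p → Prop) → ZMod p)
    (A : ZMod p → Finset α) : ZMod p × ℕ :=
  if ∀ j, #(A j) ≤ k - 1 then (σ A, ∑ j, #(A j) - 1)
  else (σ' (topClass k t c A),
    p * (k - 1) + (topColor k t c A * (p - 1) + (#{j | topClass k t c A j} - 1)))

section Family

variable {p k t : ℕ} [NeZero p] {c : Finset α → ℕ} {w : α → ℕ} {A A' : ZMod p → Finset α}

open Classical in
lemma card_topClass_lt (hno : ¬ HasMonochromaticFamily (ZMod p) w k c)
    (hadm : ∀ x, #{j | x ∈ A j} ≤ w x) : #{j | topClass k t c A j} < p := by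
  by_contra! h
  have hall (j : ZMod p) : topClass k t c A j := by
    have : ({j | topClass k t c A j} : Finset (ZMod p)) = univ :=
      eq_univ_of_card _ (le_antisymm (card_le_univ _) (by rwa [ZMod.card]))
    have hj := mem_univ j
    rw [← this] at hj
    simpa using hj
  choose B hB hBk hBc using hall
  refine hno ⟨_, B, fun j => ⟨hBk j, hBc j⟩, fun x => (card_le_card ?_).trans (hadm x)⟩
  intro j hj
  simp only [mem_filter, mem_univ, true_and] at hj ⊢
  exact hB j hj

variable {σ : (ZMod p → Finset α) → ZMod p} {σ' : (ZMod p → Prop) → ZMod p}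

lemma familyLabel_lt (hk : 1 ≤ k) (hc : ∀ B, #B = k → c B < t)
    (hno : ¬ HasMonochromaticFamily (ZMod p) w k c) (hadm : ∀ x, #{j | x ∈ A j} ≤ w x)
    (hne : ∃ j, (A j).Nonempty) :
    (familyLabel k t c σ σ' A).2 < p * (k - 1) + t * (p - 1) := by
  classical
  unfold familyLabel
  split_ifs with h
  · have h1 := card_sum_le h
    have h2 := card_sum_pos hne
    dsimp only
    omega
  · obtain ⟨h1, j, hj⟩ := topColor_lt hk hc h
    have h2 := card_topClass_lt (t := t) hno hadm
    have h3 : 0 < #{j | topClass k t c A j} := card_pos.2 ⟨j, by simpa using hj⟩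
    have h4 : (topColor k t c A + 1) * (p - 1) ≤ t * (p - 1) := Nat.mul_le_mul_right _ h1
    rw [add_mul, one_mul] at h4
    dsimp only
    omega

lemma familyLabel_mono (hk : 1 ≤ k) (hc : ∀ B, #B = k → c B < t)
    (hno : ¬ HasMonochromaticFamily (ZMod p) w k c) (hadm : ∀ x, #{j | x ∈ A' j} ≤ w x)
    (hAA : ∀ j, A j ⊆ A' j) (hne : ∃ j, (A j).Nonempty) :
    (familyLabel k t c σ σ' A).2 ≤ (familyLabel k t c σ σ' A').2 ∧
      ((familyLabel k t c σ σ' A).2 = (familyLabel k t c σ σ' A').2 →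
        familyLabel k t c σ σ' A = familyLabel k t c σ σ' A') := by
  classical
  have hpos := card_sum_pos hne
  have hcard (j) : #(A j) ≤ #(A' j) := card_le_card (hAA j)
  by_cases h' : ∀ j, #(A' j) ≤ k - 1
  · have h : ∀ j, #(A j) ≤ k - 1 := fun j => (hcard j).trans (h' j)
    have hle : ∑ j, #(A j) ≤ ∑ j, #(A' j) := sum_le_sum fun j _ => hcard j
    rw [familyLabel, familyLabel, if_pos h, if_pos h']
    refine ⟨Nat.sub_le_sub_right hle 1, fun heq => ?_⟩
    dsimp only at heq
    have heq' : ∑ j, #(A j) = ∑ j, #(A' j) := by omega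
    rw [sum_eq_sum_iff_of_le fun j _ => hcard j] at heq'
    have : A = A' := funext fun j => eq_of_subset_of_card_le (hAA j) (heq' j (mem_univ j)).ge
    rw [this]
  · by_cases h : ∀ j, #(A j) ≤ k - 1
    · have h1 := card_sum_le h
      rw [familyLabel, familyLabel, if_pos h, if_neg h']
      dsimp only
      exact ⟨by omega, fun heq => by omega⟩
    · obtain ⟨h1, j, hj⟩ := topColor_lt hk hc h
      have hA : #{j | topClass k t c A j} < p := card_topClass_lt hno fun x =>
        (card_le_card fun j hj => by
          simp only [mem_filter, mem_univ, true_and] at hj ⊢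
          exact hAA j hj).trans (hadm x)
      have hApos : 0 < #{j | topClass k t c A j} := card_pos.2 ⟨j, by simpa using hj⟩
      rw [familyLabel, familyLabel, if_neg h, if_neg h']
      dsimp only
      rcases (topColor_mono hk hc hAA h).lt_or_eq with hlt | htop
      · have h4 : (topColor k t c A + 1) * (p - 1) ≤ topColor k t c A' * (p - 1) :=
          Nat.mul_le_mul_right _ hlt
        rw [add_mul, one_mul] at h4
        exact ⟨by omega, fun heq => by omega⟩
      · have hsub : ({j | topClass k t c A j} : Finset (ZMod p)) ⊆
            ({j | topClass k t c A' j} : Finset (ZMod p)) := by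
          intro j hj
          simp only [mem_filter, mem_univ, true_and] at hj ⊢
          obtain ⟨B, hB, hBk, hBc⟩ := hj
          exact ⟨B, hB.trans (hAA j), hBk, hBc.trans htop⟩
        have hle := card_le_card hsub
        rw [← htop]
        refine ⟨by omega, fun heq => ?_⟩
        have hset := eq_of_subset_of_card_le hsub (by omega)
        have hclass : topClass k t c A = topClass k t c A' := by
          funext j
          have := Finset.ext_iff.1 hset j
          simpa using this
        rw [hclass]

lemma familyLabel_shift (hk : 1 ≤ k) (hc : ∀ B, #B = k → c B < t)
    (hno : ¬ HasMonochromaticFamily (ZMod p) w k c) (hw : ∀ x, w x < p)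
    (hadm : ∀ x, #{j | x ∈ A j} ≤ w x) (hne : ∃ j, (A j).Nonempty)
    (hσ : ∀ f : ZMod p → Finset α, (∃ a b, f a ≠ f b) → σ (fun j => f (j - 1)) = σ f + 1)
    (hσ' : ∀ f : ZMod p → Prop, (∃ a b, f a ≠ f b) → σ' (fun j => f (j - 1)) = σ' f + 1) :
    familyLabel k t c σ σ' (fun j => A (j - 1)) =
      ((familyLabel k t c σ σ' A).1 + 1, (familyLabel k t c σ σ' A).2) := by
  classical
  have hiff : (∀ j, #(A (j - 1)) ≤ k - 1) ↔ ∀ j, #(A j) ≤ k - 1 :=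
    (Equiv.subRight (1 : ZMod p)).forall_congr_right (q := fun j => #(A j) ≤ k - 1)
  have htop : topColor k t c (fun j => A (j - 1)) = topColor k t c A := by
    unfold topColor
    congr 1
    funext i
    exact propext ((Equiv.subRight (1 : ZMod p)).exists_congr_right
      (q := fun j => ∃ B ⊆ A j, #B = k ∧ c B = i))
  have hclass : topClass k t c (fun j => A (j - 1)) = fun j => topClass k t c A (j - 1) := by
    funext j
    unfold topClass
    rw [htop]
  unfold familyLabel
  by_cases h : ∀ j, #(A j) ≤ k - 1
  · rw [if_pos (hiff.2 h), if_pos h, hσ]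
    · have : ∑ j, #(A (j - 1)) = ∑ j, #(A j) :=
        (Equiv.subRight (1 : ZMod p)).sum_comp (fun j => #(A j))
      dsimp only
      rw [this]
    · by_contra! hconst
      obtain ⟨j, x, hx⟩ := hne
      have : ({j | x ∈ A j} : Finset (ZMod p)) = univ := by
        ext j'
        simpa [hconst j' j] using hx
      have h1 := hadm x
      rw [this, card_univ, ZMod.card] at h1
      exact absurd (hw x) h1.not_gt
  · rw [if_neg (mt hiff.1 h), if_neg h, hclass, hσ', htop]
    · have : #{j | topClass k t c A (j - 1)} = #{j | topClass k t c A j} :=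
        card_bij (fun j _ => j - 1) (fun j hj => by simpa using hj)
          (fun a _ b _ hab => by simpa using hab)
          (fun b hb => ⟨b + 1, by simpa using hb, by simp⟩)
      rw [this]
    · by_contra! hconst
      obtain ⟨-, j, hj⟩ := topColor_lt hk hc h
      have hlt := card_topClass_lt (t := t) hno hadm
      have : ({j | topClass k t c A j} : Finset (ZMod p)) = univ := by
        ext j'
        simpa [hconst j' j] using hj
      rw [this, card_univ, ZMod.card] at hlt
      exact lt_irrefl _ hlt

end Family

lemma exists_fiber_card_le [Fintype α] [Nonempty α] (w : α → ℕ) :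
    ∃ β : ℕ → α, ∀ x, #{i ∈ range (∑ x, w x) | β i = x} ≤ w x := by
  classical
  obtain ⟨e⟩ : Nonempty (Fin (∑ x, w x) ≃ Σ x, Fin (w x)) :=
    Fintype.card_eq.1 (by simp)
  refine ⟨fun i => if h : i < ∑ x, w x then (e ⟨i, h⟩).1 else Classical.arbitrary α, fun x => ?_⟩
  refine (card_le_card (t := univ.image fun a : Fin (w x) => (e.symm ⟨x, a⟩ : ℕ)) ?_).trans
    (card_image_le.trans (by simp))
  intro i hmem
  obtain ⟨hi, hx⟩ := mem_filter.1 hmem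
  rw [mem_range] at hi
  simp only [dif_pos hi] at hx
  subst hx
  exact mem_image.2 ⟨(e ⟨i, hi⟩).2, mem_univ _, by simp⟩

/-- The family of sets of elements carrying each sign in a word, read through `β`. -/
def signSets {p : ℕ} (β : ℕ → α) (u : SignedWord p) (j : ZMod p) : Finset α :=
  ((u.filter (·.1 = j)).map (β ·.2)).toFinset

section SignSets

variable {p : ℕ} {β : ℕ → α} {u v : SignedWord p}

lemma mem_signSets {j : ZMod p} {x : α} : x ∈ signSets β u j ↔ ∃ i, (j, i) ∈ u ∧ β i = x := by
  simp only [signSets, List.mem_toFinset, List.mem_map, List.mem_filter, decide_eq_true_eq]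
  constructor
  · rintro ⟨⟨_, i⟩, ⟨hu, rfl⟩, rfl⟩
    exact ⟨i, hu, rfl⟩
  · rintro ⟨i, hu, rfl⟩
    exact ⟨(j, i), ⟨hu, rfl⟩, rfl⟩

lemma signSets_mono (h : u.Sublist v) (j : ZMod p) : signSets β u j ⊆ signSets β v j := by
  intro x
  simp only [mem_signSets]
  rintro ⟨i, hi, rfl⟩
  exact ⟨i, h.subset hi, rfl⟩

lemma exists_signSets_nonempty (hu : u ≠ []) : ∃ j, (signSets β u j).Nonempty := by
  obtain ⟨⟨j, i⟩, ha⟩ := List.exists_mem_of_ne_nil u hu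
  exact ⟨j, β i, mem_signSets.2 ⟨i, ha, rfl⟩⟩

lemma signSets_rot : signSets β (SignedWord.rot u) = fun j => signSets β u (j - 1) := by
  funext j
  ext x
  simp only [mem_signSets, SignedWord.rot, List.mem_map]
  constructor
  · rintro ⟨i, ⟨⟨j', i'⟩, hu, h⟩, rfl⟩
    obtain ⟨rfl, rfl⟩ := Prod.ext_iff.1 h
    exact ⟨i', by simpa using hu, rfl⟩
  · rintro ⟨i, hu, rfl⟩
    exact ⟨i, ⟨(j - 1, i), hu, Prod.ext (by simp) rfl⟩, rfl⟩

lemma card_signSets_le [NeZero p] {N : ℕ} (hu : u ∈ SignedWord.good p N) (x : α) :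
    #{j | x ∈ signSets β u j} ≤ #{i ∈ range N | β i = x} := by
  have hmem (j : ZMod p) (hj : j ∈ ({j | x ∈ signSets β u j} : Finset (ZMod p))) :
      ∃ i, (j, i) ∈ u ∧ β i = x := mem_signSets.1 (mem_filter.1 hj).2
  choose! f hf using hmem
  have hnodup : (u.map Prod.snd).Nodup :=
    List.pairwise_map.2 (hu.1.imp fun h => h.ne')
  refine card_le_card_of_injOn f (fun j hj => ?_) fun a ha b hb hab => ?_
  · have h := hf j hj
    exact mem_filter.2 ⟨mem_range.2 (hu.2 _ h.1), h.2⟩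
  · have := List.inj_on_of_nodup_map hnodup (hf a ha).1 (hf b hb).1 hab
    exact congrArg Prod.fst this

end SignSets

lemma hasMonochromaticFamily_of_lt_prime [Fintype α] {p : ℕ} [Fact p.Prime] {w : α → ℕ}
    (hw : ∀ x, w x < p) {k t : ℕ} (hk : 1 ≤ k) {c : Finset α → ℕ} (hc : ∀ B, c B < t)
    (hsum : t * (p - 1) + p * (k - 1) < ∑ x, w x) : HasMonochromaticFamily (ZMod p) w k c := by
  by_contra hno
  have : Nonempty α := by
    by_contra h
    rw [not_nonempty_iff] at h
    simp at hsum
  obtain ⟨β, hβ⟩ := exists_fiber_card_le w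
  obtain ⟨σ, hσ⟩ := exists_equivariant_sign p (Finset α)
  obtain ⟨σ', hσ'⟩ := exists_equivariant_sign p Prop
  have hck (B : Finset α) (_ : #B = k) : c B < t := hc B
  have hadm {u : SignedWord p} (hu : u ∈ SignedWord.good p (∑ x, w x)) (x : α) :
      #{j | x ∈ signSets β u j} ≤ w x := (card_signSets_le hu x).trans (hβ x)
  have hmono {u v : SignedWord p} (h : u.Sublist v)
      (hv : v ∈ SignedWord.good p (∑ x, w x)) (hu : u ≠ []) :=
    familyLabel_mono (σ := σ) (σ' := σ') hk hck hno (hadm hv) (signSets_mono h)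
      (exists_signSets_nonempty (β := β) hu)
  have hlab : SignedWord.IsLabelling (∑ x, w x) (p * (k - 1) + t * (p - 1))
      fun u => familyLabel k t c σ σ' (signSets β u) :=
    { lt := fun u hu hne =>
        familyLabel_lt hk hck hno (hadm hu) (exists_signSets_nonempty hne)
      mono := fun u v h hv hne => (hmono h hv hne).1
      eq_of_eq := fun u v h hv hne => (hmono h hv hne).2
      rot := fun u hu hne => by
        rw [signSets_rot]
        exact familyLabel_shift hk hck hno hw (hadm hu) (exists_signSets_nonempty hne) hσ hσ' }
  have := hlab.le (Fact.out : p.Prime).ne_one (by omega)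
  omega

/-- The Kneser-type bound for `r`-fold families: with too few colors for the total weight,
there is a monochromatic family. -/
def KneserBound (α : Type*) [DecidableEq α] [Fintype α] (r : ℕ) : Prop :=
  ∀ ⦃w : α → ℕ⦄ ⦃k t : ℕ⦄ ⦃c : Finset α → ℕ⦄, 1 ≤ k → (∀ B, c B < t) →
    t * (r - 1) + r * (k - 1) < ∑ x, min (w x) r → HasMonochromaticFamily (Fin r) w k c

lemma kneserBound_prime [Fintype α] {p : ℕ} (hp : p.Prime) : KneserBound α p := by
  intro w k t c hk hc hsum
  have : Fact p.Prime := ⟨hp⟩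
  set F : Finset α := {x | p ≤ w x} with hF
  have memF (x : α) : x ∈ F ↔ p ≤ w x := by simp [hF]
  by_cases hkF : k ≤ #F
  · obtain ⟨B, hBF, hB⟩ := exists_subset_card_eq hkF
    refine ⟨c B, fun _ => B, fun _ => ⟨hB, rfl⟩, fun x => ?_⟩
    by_cases hx : x ∈ B
    · exact (card_le_univ _).trans ((Fintype.card_fin p).trans_le ((memF x).1 (hBF hx)))
    · simp [hx]
  · set w' : α → ℕ := fun x => if x ∈ F then 0 else w x with hw'
    have hsplit : ∑ x, min (w x) p = ∑ x, w' x + #F * p := by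
      have : #F * p = ∑ x, if x ∈ F then p else 0 := by simp
      rw [this, ← sum_add_distrib]
      refine sum_congr rfl fun x _ => ?_
      simp only [hw', memF]
      split_ifs with h <;> omega
    have hlt (x : α) : w' x < p := by
      simp only [hw', memF]
      split_ifs with h
      · exact hp.pos
      · omega
    have hpk : p * (k - 1) = p * (k - #F - 1) + #F * p := by
      rw [mul_comm #F, ← mul_add]
      congr 1
      omega
    obtain ⟨i, A, hA, hAw⟩ := (hasMonochromaticFamily_of_lt_prime hlt (k := k - #F) (t := t)
      (c := fun A => c (A ∪ F)) (by omega) (fun A => hc _) (by omega)).congr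
        (Fintype.equivOfCardEq (by simp [ZMod.card]) : Fin p ≃ ZMod p)
    have hdisj (j : Fin p) : Disjoint (A j) F := by
      refine disjoint_left.2 fun x hx hxF => ?_
      have h1 := hAw x
      rw [hw'] at h1
      simp only [if_pos hxF, Nat.le_zero, card_eq_zero] at h1
      exact absurd (mem_filter.2 ⟨mem_univ j, hx⟩) (h1 ▸ notMem_empty j)
    refine ⟨i, fun j => A j ∪ F, fun j => ⟨?_, (hA j).2⟩, fun x => ?_⟩
    · rw [card_union_of_disjoint (hdisj j), (hA j).1]
      omega
    · by_cases hx : x ∈ F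
      · exact (card_le_univ _).trans ((Fintype.card_fin p).trans_le ((memF x).1 hx))
      · simpa [hx, hw'] using hAw x

lemma hasMonochromaticFamily_mul {p r k i : ℕ} {c : Finset α → ℕ} {w v : α → ℕ}
    (H : Fin r → Finset α) (A : Fin r → Fin p → Finset α)
    (hA : ∀ j a, #(A j a) = k ∧ c (A j a) = i)
    (hv : ∀ j x, #{a | x ∈ A j a} ≤ v x + if x ∈ H j then 1 else 0)
    (hw : ∀ x, r * v x + #{j | x ∈ H j} ≤ w x) :
    HasMonochromaticFamily (Fin (p * r)) w k c := by
  refine HasMonochromaticFamily.congr finProdFinEquiv.symm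
    ⟨i, fun q => A q.2 q.1, fun q => hA q.2 q.1, fun x => le_trans ?_ (hw x)⟩
  calc #{q : Fin p × Fin r | x ∈ A q.2 q.1} = ∑ j, #{a | x ∈ A j a} := by
        simp only [card_filter, Fintype.sum_prod_type_right]
    _ ≤ ∑ j, (v x + if x ∈ H j then 1 else 0) := sum_le_sum fun j _ => hv j x
    _ = r * v x + #{j | x ∈ H j} := by simp [sum_add_distrib]

lemma KneserBound.mul [Fintype α] {p r : ℕ} (hp : 0 < p) (hP : KneserBound α p)
    (hR : KneserBound α r) : KneserBound α (p * r) := by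
  intro w k t c hk hc hsum
  rcases Nat.eq_zero_or_pos r with rfl | hr
  · simp at hsum
  set W : α → ℕ := fun x => min (w x) (p * r) with hW
  replace hsum : t * (p * r - 1) + p * r * (k - 1) < ∑ x, W x := hsum
  set v : α → ℕ := fun x => W x / r with hv
  have hWv (x : α) : r * v x + W x % r = W x := Nat.div_add_mod _ _
  have hvp (x : α) : v x ≤ p := (Nat.div_le_iff_le_mul_add_pred hr).2 (by
    have : W x ≤ p * r := min_le_right _ _
    rw [mul_comm r]; omega)
  have hWw (x : α) : W x ≤ w x := min_le_left _ _
  by_cases hV : t * (p - 1) + p * (k - 1) < ∑ x, v x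
  · obtain ⟨i, A, hA, hAv⟩ := hP (w := v) hk hc (by simpa only [min_eq_left (hvp _)] using hV)
    refine hasMonochromaticFamily_mul (i := i) (v := v) (fun _ => ∅) (fun _ => A)
      (fun _ => hA) (fun _ x => by simpa using hAv x) fun x => ?_
    have := hWv x
    have := hWw x
    simp only [notMem_empty, filter_false, card_empty]
    omega
  push Not at hV
  set K := t * (p - 1) + p * (k - 1) + 1 - ∑ x, v x with hK
  have hex (H : Finset α) : ∃ i < t, #H = K → (∀ x ∈ H, v x < p) → ∃ A : Fin p → Finset α,
      (∀ j, #(A j) = k ∧ c (A j) = i) ∧ ∀ x, #{j | x ∈ A j} ≤ v x + if x ∈ H then 1 else 0 := by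
    by_cases hH : #H = K ∧ ∀ x ∈ H, v x < p
    · obtain ⟨i, A, hA, hAw⟩ := hP (w := fun x => v x + if x ∈ H then 1 else 0) (t := t) hk hc (by
        have (x : α) : min (v x + if x ∈ H then 1 else 0) p = v x + if x ∈ H then 1 else 0 := by
          refine min_eq_left ?_
          split_ifs with hx
          · exact hH.2 x hx
          · exact hvp x
        simp only [this, sum_add_distrib, sum_ite_mem, univ_inter, sum_const, smul_eq_mul, mul_one]
        omega)
      refine ⟨i, ?_, fun _ _ => ⟨A, hA, hAw⟩⟩
      rw [← (hA ⟨0, hp⟩).2]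
      exact hc _
    · exact ⟨c ∅, hc ∅, fun h1 h2 => absurd ⟨h1, h2⟩ hH⟩
  choose c' hc' hfam using hex
  obtain ⟨i, H, hH, hHw⟩ := hR (w := fun x => W x % r) (k := K) (by omega) hc' (by
    have hu : ∑ x, min (W x % r) r + r * ∑ x, v x = ∑ x, W x := by
      rw [mul_sum, ← sum_add_distrib]
      refine sum_congr rfl fun x _ => ?_
      rw [min_eq_left (Nat.mod_lt _ hr).le, add_comm, hWv]
    have hK1 : r * (K - 1) + r * ∑ x, v x = r * (t * (p - 1)) + p * r * (k - 1) := by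
      rw [mul_comm p r, mul_assoc, ← mul_add, ← mul_add]
      congr 1
      omega
    have ht : r * (t * (p - 1)) + t * (r - 1) = t * (p * r - 1) := by
      obtain ⟨p, rfl⟩ := Nat.exists_eq_add_of_lt hp
      obtain ⟨r, rfl⟩ := Nat.exists_eq_add_of_lt hr
      simp only [zero_add, Nat.add_sub_cancel]
      rw [show (p + 1) * (r + 1) - 1 = (r + 1) * p + r by
        rw [Nat.sub_eq_of_eq_add]; ring]
      ring
    omega)
  have hHv (j : Fin r) (x : α) (hx : x ∈ H j) : v x < p := by
    have h1 : 0 < #{j | x ∈ H j} := card_pos.2 ⟨j, by simpa using hx⟩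
    have h2 := hHw x
    have h3 := hWv x
    have h4 : W x ≤ p * r := min_le_right _ _
    by_contra! h
    have := Nat.mul_le_mul_left r h
    rw [mul_comm p] at h4
    dsimp only at h2
    omega
  choose A hA hAv using fun j => hfam (H j) (hH j).1 (hHv j)
  refine hasMonochromaticFamily_mul H A (fun j a => ⟨(hA j a).1, (hA j a).2.trans (hH j).2⟩) hAv
    fun x => ?_
  have h1 := hHw x
  have h2 := hWv x
  have h3 := hWw x
  dsimp only at h1
  omega

lemma kneserBound_one [Fintype α] : KneserBound α 1 := by
  intro w k t c hk hc hsum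
  have hcard : k ≤ #{x | 1 ≤ w x} := by
    have : ∑ x, min (w x) 1 = #{x | 1 ≤ w x} := by
      rw [card_filter]
      refine sum_congr rfl fun x _ => ?_
      split_ifs with h <;> omega
    omega
  obtain ⟨B, hBF, hB⟩ := exists_subset_card_eq hcard
  refine ⟨c B, fun _ => B, fun _ => ⟨hB, rfl⟩, fun x => ?_⟩
  by_cases hx : x ∈ B
  · exact (card_le_univ _).trans (by simpa using hBF hx)
  · simp [hx]

lemma kneserBound [Fintype α] (r : ℕ) : KneserBound α r := by
  induction r using induction_on_primes with
  | zero => intro w k t c _ _ hsum; simp at hsum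
  | one => exact kneserBound_one
  | prime_mul p a hp ih => exact (kneserBound_prime hp).mul hp.pos ih

end Kneser

lemma not_isProperColoring_of_lt {n k r s t : ℕ} (hk : 1 ≤ k) (hsr : s ≤ r)
    (hlt : t * (r - 1) + r * (k - 1) < n * s) (c : KGSVertex n k → Fin t) :
    ¬ IsProperColoring (KGSEdges n k r fun _ => s) c := by
  intro hc
  have hkn : k ≤ n := by
    by_contra! h
    have : n * s ≤ (k - 1) * r := Nat.mul_le_mul (by omega) hsr
    rw [mul_comm (k - 1)] at this
    omega
  have hr : 0 < r := by
    by_contra! h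
    obtain rfl : s = 0 := by omega
    simp at hlt
  obtain ⟨B₀, -, hB₀⟩ := exists_subset_card_eq (s := (univ : Finset (Fin n))) (by simpa using hkn)
  have ht : 0 < t := (c ⟨B₀, hB₀⟩).pos
  have hext (B : Finset (Fin n)) : ∃ i < t, ∀ A : KGSVertex n k, A.1 = B → (c A : ℕ) = i := by
    by_cases hB : #B = k
    · exact ⟨_, (c ⟨B, hB⟩).2, by rintro ⟨A, hA⟩ rfl; rfl⟩
    · exact ⟨0, ht, fun A hA => absurd (hA ▸ A.2) hB⟩
  choose c' hc' hcc' using hext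
  obtain ⟨i, A, hA, hAs⟩ := kneserBound (α := Fin n) r (w := fun _ => s) hk hc'
    (by simpa [min_eq_left hsr] using hlt)
  let f (j : Fin r) : KGSVertex n k := ⟨A j, (hA j).1⟩
  have hf (j : Fin r) : (c (f j) : ℕ) = i := (hcc' _ (f j) rfl).trans (hA j).2
  obtain ⟨a, ha, b, hb, hab⟩ := hc (univ.val.map f) ⟨by simp, fun x => by
    rw [Multiset.filter_map, Multiset.card_map]
    exact hAs x⟩
  obtain ⟨j, -, rfl⟩ := Multiset.mem_map.1 ha
  obtain ⟨j', -, rfl⟩ := Multiset.mem_map.1 hb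
  exact hab (Fin.ext ((hf j).trans (hf j').symm))

lemma card_mul_le_of_mem_KGSEdges {n k r s q : ℕ} {e : Multiset (KGSVertex n k)}
    (he : e ∈ KGSEdges n k r fun _ => s) (U : Finset (Fin n))
    (hU : ∀ A ∈ e, q ≤ #{x ∈ U | x ∈ A.1}) :
    r * q ≤ #U * s := by
  have hcount : (e.map fun A => #{x ∈ U | x ∈ A.1}).sum =
      ∑ x ∈ U, (e.filter fun A => x ∈ A.1).card := by
    clear he hU
    induction e using Multiset.induction with
    | empty => simp
    | cons A e ih =>
      rw [Multiset.map_cons, Multiset.sum_cons, ih, card_filter, ← sum_add_distrib]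
      refine sum_congr rfl fun x _ => ?_
      rw [Multiset.filter_cons, Multiset.card_add]
      split_ifs <;> simp
  have h1 := Multiset.card_nsmul_le_sum (s := e.map fun A => #{x ∈ U | x ∈ A.1}) (a := q)
    (by simpa using hU)
  rw [Multiset.card_map, he.1, smul_eq_mul, hcount] at h1
  exact h1.trans (sum_le_card_nsmul U _ s fun x _ => he.2 x)

lemma exists_isProperColoring_s4 {n k r m s t : ℕ} (hk : 1 ≤ k) (hms : m * s < r) (hm : 0 < m)
    (ht : 0 < t) (hlt : n * s < (t - 1) * (m * s) + r * k) :
    ∃ c : KGSVertex n k → Fin t, IsProperColoring (KGSEdges n k r fun _ => s) c := by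
  let f (x : Fin n) : ℕ := min (x / m) (t - 1)
  have hmin (A : KGSVertex n k) : ∃ x ∈ A.1, ∀ y ∈ A.1, f x ≤ f y :=
    exists_min_image A.1 f (card_pos.1 (by rw [A.2]; exact hk))
  choose g hg hgf using hmin
  refine ⟨fun A => ⟨f (g A), (min_le_right _ _).trans_lt (by omega)⟩, fun e he => ?_⟩
  by_contra! hmono
  obtain ⟨A₀, hA₀⟩ := Multiset.card_pos_iff_exists_mem.1 (he.1.symm ▸ (Nat.zero_le _).trans_lt hms)
  set i := f (g A₀)
  have hi (A) (hA : A ∈ e) : f (g A) = i := congrArg Fin.val (hmono A hA A₀ hA₀)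
  rcases lt_or_ge i (t - 1) with hit | hit
  · have hcard : #{x : Fin n | f x = i} ≤ m := by
      refine (card_le_card_of_injOn (t := Ico (i * m) (i * m + m)) Fin.val (fun x hx => ?_)
        Fin.val_injective.injOn).trans (by simp)
      have hx' : (x : ℕ) / m = i := by
        have : min ((x : ℕ) / m) (t - 1) = i := by simpa using hx
        omega
      have h1 := Nat.div_mul_le_self x m
      have h2 := Nat.lt_div_mul_add (a := x) hm
      rw [hx'] at h1 h2
      simpa using ⟨h1, h2⟩
    have := card_mul_le_of_mem_KGSEdges (q := 1) he {x | f x = i} fun A hA =>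
      card_pos.2 ⟨g A, by simp [hg A, hi A hA]⟩
    have := this.trans (Nat.mul_le_mul_right s hcard)
    omega
  · have hcard : #{x : Fin n | (t - 1) * m ≤ x} ≤ n - (t - 1) * m := by
      refine (card_le_card_of_injOn (t := Ico ((t - 1) * m) n) Fin.val (fun x hx => ?_)
        Fin.val_injective.injOn).trans (by simp)
      simpa using hx
    have := card_mul_le_of_mem_KGSEdges (q := k) he {x | (t - 1) * m ≤ x} fun A hA => by
      refine A.2.symm.le.trans (card_le_card fun y hy => ?_)
      have h1 : t - 1 ≤ f y := hit.trans ((hi A hA).symm.le.trans (hgf A y hy))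
      have h2 : t - 1 ≤ (y : ℕ) / m := h1.trans (min_le_left _ _)
      simpa [hy] using (Nat.le_div_iff_mul_le hm).1 h2
    have := this.trans (Nat.mul_le_mul_right s hcard)
    rw [Nat.sub_mul, mul_assoc] at this
    have : 0 < r * k := Nat.mul_pos (by omega) hk
    omega

theorem chromatic_KGS_const_eq (n k r s : ℕ)
    (hk : 1 ≤ k) (hs : 1 ≤ s) (hsr : s < r) (hdvd : s ∣ (r - 1))
    (hsum : r * k ≤ n * s) :
    hypChromatic (KGSEdges n k r (fun _ => s)) =
      ((n * s - r * (k - 1)) ⌈/⌉ (r - 1) : ℕ) := by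
  have hr : 0 < r - 1 := by omega
  have hrk : r * k = r * (k - 1) + r := by
    rw [← Nat.mul_succ, Nat.succ_eq_add_one, Nat.sub_add_cancel hk]
  have hle (t : ℕ) : (n * s - r * (k - 1)) ⌈/⌉ (r - 1) ≤ t ↔
      n * s ≤ t * (r - 1) + r * (k - 1) := by
    rw [ceilDiv_le_iff_le_smul hr, smul_eq_mul, mul_comm (r - 1), tsub_le_iff_right]
  apply le_antisymm
  · set T := (n * s - r * (k - 1)) ⌈/⌉ (r - 1)
    obtain ⟨m, hm⟩ := hdvd
    have hT : n * s ≤ T * (r - 1) + r * (k - 1) := (hle T).1 le_rfl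
    have hT0 : 0 < T := by
      by_contra! h
      rw [Nat.le_zero.1 h] at hT
      omega
    have hTsub : T * (r - 1) = (T - 1) * (r - 1) + (r - 1) := by
      rw [← Nat.succ_mul, Nat.succ_eq_add_one, Nat.sub_add_cancel hT0]
    rw [mul_comm] at hm
    exact sInf_le ⟨T, rfl, exists_isProperColoring_s4 (m := m) hk (by omega)
      (Nat.pos_of_ne_zero (by rintro rfl; omega)) hT0 (by rw [← hm]; omega)⟩
  · refine le_sInf ?_
    rintro _ ⟨t, rfl, c, hc⟩
    rw [Nat.cast_le, hle]
    by_contra! hlt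
    exact not_isProperColoring_of_lt hk hsr.le hlt c hc
end
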